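/- arXiv:2602.12219 — 3 statements merged into one kernel-verified Lean document; each statement's English description precedes it below -/
import Mathlib

section
/- Let Ω be a finite set with n elements and let k ≤ n/2 be a positive integer. If 𝓕 is a family of k-element subsets of Ω such that any two members of 𝓕 have nonempty intersection, then |𝓕| ≤ C(n−1, k−1). Moreover, if n ≥ 2k+1, equality holds if and only if 𝓕 consists of all k-element subsets of Ω containing some fixed element of Ω. -/
open Finset in
theorem ekr_nat_bound (n k : ℕ) (h2 : 2 * k ≤ n) (hk : 1 ≤ k) (J : Finset ℕ)
    (hJ : ∀ v ∈ J, v < n) (h0 : 0 ∈ J)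
    (hd : ∀ u ∈ J, ∀ v ∈ J, u < v → v - u < k ∨ n - k < v - u) :
    Set.MapsTo (fun v => if v < k then v else v - (n - k)) (J : Set ℕ) (range k : Set ℕ) ∧
    Set.InjOn (fun v => if v < k then v else v - (n - k)) (J : Set ℕ) := by
  constructor
  · intro v hv
    have h1 := hJ v hv
    have h3 := hd 0 h0 v hv
    simp only [coe_range, Set.mem_Iio]
    split_ifs <;> omega
  · intro u hu v hv h
    have h1 := hJ v hv
    have h3 := hd 0 h0 v hv
    have h1' := hJ u hu
    have h3' := hd 0 h0 u hu
    have h4 := hd u hu v hv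
    have h5 := hd v hv u hu
    simp only at h
    split_ifs at h <;> omega

open Finset in
theorem ekr_nat_eq (n k : ℕ) (h2 : 2 * k < n) (hk : 1 ≤ k) (J : Finset ℕ)
    (hJ : ∀ v ∈ J, v < n) (h0 : 0 ∈ J) (h1 : 1 ∉ J) (hc : J.card = k)
    (hd : ∀ u ∈ J, ∀ v ∈ J, u < v → v - u < k ∨ n - k < v - u) :
    ∀ i, 1 ≤ i → i < k → i + (n - k) ∈ J := by
  obtain ⟨hm, hi⟩ := ekr_nat_bound n k h2.le hk J hJ h0 hd
  have hs : Set.SurjOn (fun v => if v < k then v else v - (n - k)) (J : Set ℕ) (range k : Set ℕ) :=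
    Finset.surjOn_of_injOn_of_card_le _ hm hi (by simp [hc])
  have step : ∀ i, 1 ≤ i → i < k → i ∉ J → i + (n - k) ∈ J := by
    intro i hi1 hik hiJ
    obtain ⟨v, hv, hvi⟩ := hs (by simpa using hik : i ∈ (range k : Set ℕ))
    have hv' : v ∈ J := hv
    simp only at hvi
    split_ifs at hvi with h
    · subst hvi; exact absurd hv' hiJ
    · have : v = i + (n - k) := by omega
      rwa [← this]
  have main : ∀ i, 1 ≤ i → i < k → i ∉ J := by
    intro i hi1
    induction i, hi1 using Nat.le_induction with
    | base => intro _; exact h1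
    | succ i hi1 ih =>
      intro hik hmem
      have := step i hi1 (by omega) (ih (by omega))
      have := hd _ hmem _ this (by omega)
      omega
  intro i h h'
  exact step i h h' (main i h h')

theorem ekr_val_sub {n : ℕ} [NeZero n] (a b : ZMod n) :
    (a - b).val + b.val = a.val ∨ (a - b).val + b.val = a.val + n := by
  have h := ZMod.val_add (a - b) b
  rw [sub_add_cancel] at h
  have h1 := ZMod.val_lt (a - b)
  have h2 := ZMod.val_lt b
  rcases lt_or_ge ((a - b).val + b.val) n with h3 | h3
  · rw [Nat.mod_eq_of_lt h3] at h; omega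
  · rw [Nat.mod_eq_sub_mod h3, Nat.mod_eq_of_lt (by omega)] at h; omega

open Finset in
theorem ekr_card_val {n : ℕ} [NeZero n] (l r : ℕ) (hr : r ≤ n) :
    (univ.filter (fun y : ZMod n => l ≤ y.val ∧ y.val < r)).card = r - l := by
  rw [← Nat.card_Ico]
  refine card_bij (fun y _ => y.val) ?_ ?_ ?_
  · intro y hy; simpa using hy
  · intro a _ b _ h; exact ZMod.val_injective n h
  · intro m hm
    rw [mem_Ico] at hm
    have : (m : ZMod n).val = m := ZMod.val_cast_of_lt (by omega)
    exact ⟨(m : ZMod n), by simp [this, hm], this⟩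

section
variable {Ω : Type*} [Fintype Ω] [DecidableEq Ω] {n : ℕ} [NeZero n]

def ekrArc (k : ℕ) (σ : ZMod n ≃ Ω) (i : ZMod n) : Finset Ω :=
  Finset.univ.filter (fun x => (σ.symm x - i).val < k)

open Finset

theorem ekr_arc_shift (k : ℕ) (σ : ZMod n ≃ Ω) (i : ZMod n) :
    ekrArc k ((Equiv.addRight i).trans σ) 0 = ekrArc k σ i := by
  ext x; simp [ekrArc, sub_eq_add_neg]

theorem ekr_arc_card (k : ℕ) (hk : k ≤ n) (σ : ZMod n ≃ Ω) (i : ZMod n) :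
    (ekrArc k σ i).card = k := by
  rw [← ekr_arc_shift]
  have := ekr_card_val (n := n) 0 k hk
  rw [Nat.sub_zero] at this
  conv_rhs => rw [← this]
  refine card_bij (fun x _ => ((Equiv.addRight i).trans σ).symm x) ?_ ?_ ?_
  · intro x hx
    simpa [ekrArc] using hx
  · intro a _ b _ h
    exact (Equiv.injective _) h
  · intro y hy
    exact ⟨((Equiv.addRight i).trans σ) y, by simpa [ekrArc] using hy, by simp⟩

theorem ekr_arc_rel (k : ℕ) (hk : 2 * k ≤ n) (σ : ZMod n ≃ Ω) (i0 i j : ZMod n)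
    (h : (ekrArc k σ i ∩ ekrArc k σ j).Nonempty) (hlt : (i - i0).val < (j - i0).val) :
    (j - i0).val - (i - i0).val < k ∨ n - k < (j - i0).val - (i - i0).val := by
  obtain ⟨x, hx⟩ := h
  simp only [ekrArc, mem_inter, mem_filter, mem_univ, true_and] at hx
  set y := σ.symm x
  have h1 := ekr_val_sub (y - i0) (i - i0)
  have h2 := ekr_val_sub (y - i0) (j - i0)
  rw [sub_sub_sub_cancel_right] at h1 h2
  have := ZMod.val_lt (y - i0)
  have := ZMod.val_lt (i - i0)
  have := ZMod.val_lt (j - i0)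
  omega

def ekrIdx (k : ℕ) (𝓕 : Finset (Finset Ω)) (σ : ZMod n ≃ Ω) : Finset (ZMod n) :=
  univ.filter (fun i => ekrArc k σ i ∈ 𝓕)

theorem ekr_idx_J (k : ℕ) (hk : 2 * k ≤ n) (𝓕 : Finset (Finset Ω))
    (hint : ∀ A ∈ 𝓕, ∀ B ∈ 𝓕, (A ∩ B).Nonempty) (σ : ZMod n ≃ Ω) (i0 : ZMod n) :
    ∀ u ∈ (ekrIdx k 𝓕 σ).image (fun i => (i - i0).val),
    ∀ v ∈ (ekrIdx k 𝓕 σ).image (fun i => (i - i0).val), u < v → v - u < k ∨ n - k < v - u := by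
  intro u hu v hv huv
  simp only [ekrIdx, mem_image, mem_filter, mem_univ, true_and] at hu hv
  obtain ⟨i, hi, rfl⟩ := hu
  obtain ⟨j, hj, rfl⟩ := hv
  exact ekr_arc_rel k hk σ i0 i j (hint _ hi _ hj) huv

theorem ekr_idx_card_image (k : ℕ) (𝓕 : Finset (Finset Ω)) (σ : ZMod n ≃ Ω) (i0 : ZMod n) :
    ((ekrIdx k 𝓕 σ).image (fun i => (i - i0).val)).card = (ekrIdx k 𝓕 σ).card := by
  apply card_image_of_injective
  intro a b h
  simpa using ZMod.val_injective n h

theorem ekr_idx_le (k : ℕ) (hk1 : 1 ≤ k) (hk : 2 * k ≤ n) (𝓕 : Finset (Finset Ω))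
    (hint : ∀ A ∈ 𝓕, ∀ B ∈ 𝓕, (A ∩ B).Nonempty) (σ : ZMod n ≃ Ω) :
    (ekrIdx k 𝓕 σ).card ≤ k := by
  rcases (ekrIdx k 𝓕 σ).eq_empty_or_nonempty with h | ⟨i0, h0⟩
  · simp [h]
  rw [← ekr_idx_card_image k 𝓕 σ i0]
  have a1 : ∀ v ∈ (ekrIdx k 𝓕 σ).image (fun i => (i - i0).val), v < n := by
    intro v hv
    obtain ⟨i, _, rfl⟩ := mem_image.1 hv
    exact ZMod.val_lt _
  have a2 : 0 ∈ (ekrIdx k 𝓕 σ).image (fun i => (i - i0).val) :=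
    mem_image.2 ⟨i0, h0, by simp⟩
  obtain ⟨hm, hi⟩ := ekr_nat_bound n k hk hk1 _ a1 a2 (ekr_idx_J k hk 𝓕 hint σ i0)
  simpa using Finset.card_le_card_of_injOn _ hm hi

theorem ekr_idx_eq (k : ℕ) (hk1 : 1 ≤ k) (hk : 2 * k < n) (𝓕 : Finset (Finset Ω))
    (hint : ∀ A ∈ 𝓕, ∀ B ∈ 𝓕, (A ∩ B).Nonempty) (σ : ZMod n ≃ Ω)
    (hc : (ekrIdx k 𝓕 σ).card = k) (h0 : ekrArc k σ 0 ∈ 𝓕) (h1 : ekrArc k σ 1 ∉ 𝓕)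
    (t : ℕ) (ht : 1 ≤ t) (htk : t < k) : ekrArc k σ ((n - t : ℕ) : ZMod n) ∈ 𝓕 := by
  have := ekr_nat_eq n k hk hk1 ((ekrIdx k 𝓕 σ).image (fun i => (i - 0).val)) ?_ ?_ ?_ ?_
    (ekr_idx_J k hk.le 𝓕 hint σ 0) (k - t) (by omega) (by omega)
  · obtain ⟨i, hi, hi'⟩ := mem_image.1 this
    have e : i = ((n - t : ℕ) : ZMod n) := by
      rw [sub_zero] at hi'
      rw [← ZMod.natCast_zmod_val i, hi']
      congr 1; omega
    subst e
    simpa [ekrIdx] using hi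
  · intro v hv
    obtain ⟨i, _, rfl⟩ := mem_image.1 hv
    exact ZMod.val_lt _
  · exact mem_image.2 ⟨0, by simpa [ekrIdx] using h0, by simp⟩
  · intro h
    obtain ⟨i, hi, hi'⟩ := mem_image.1 h
    have e : i = 1 := by
      rw [sub_zero] at hi'
      rw [← ZMod.natCast_zmod_val i, hi', Nat.cast_one]
    subst e
    exact h1 (by simpa [ekrIdx] using hi)
  · rw [ekr_idx_card_image, hc]

/-- number of orderings with given base arc -/
def ekrCnt (n : ℕ) [NeZero n] (k : ℕ) (A : Finset Ω) : ℕ :=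
  (univ.filter (fun σ : ZMod n ≃ Ω => ekrArc k σ 0 = A)).card

theorem ekr_cnt_le (k : ℕ) (A B : Finset Ω) (h : A.card = B.card) :
    ekrCnt n k A ≤ ekrCnt n k B := by
  obtain ⟨π, hπ⟩ : ∃ π : Equiv.Perm Ω, ∀ x, π x ∈ B ↔ x ∈ A := by
    have e1 : Fintype.card {x // x ∈ A} = Fintype.card {x // x ∈ B} := by simpa using h
    have e2 := Fintype.equivOfCardEq e1
    refine ⟨e2.extendSubtype, fun x => ?_⟩
    by_cases hx : x ∈ A
    · simp [hx, e2.extendSubtype_mem x hx]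
    · simp [hx, e2.extendSubtype_not_mem x hx]
  refine card_le_card_of_injOn (fun σ => σ.trans π) ?_ ?_
  · intro σ hσ
    have hσ' : ekrArc k σ 0 = A := by simpa using hσ
    have : ekrArc k (σ.trans π) 0 = B := by
      ext x
      have := hπ (π.symm x)
      rw [Equiv.apply_symm_apply] at this
      rw [this, ← hσ']
      simp [ekrArc]
    simpa using this
  · intro σ _ τ _ h
    ext x
    have := congrArg (fun f => f x) h
    simpa using this

theorem ekr_sum_idx (k : ℕ) (𝓕 : Finset (Finset Ω)) :
    ∑ σ : ZMod n ≃ Ω, (ekrIdx k 𝓕 σ).card = n * ∑ A ∈ 𝓕, ekrCnt n k A := by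
  have h1 : ∀ σ : ZMod n ≃ Ω, (ekrIdx k 𝓕 σ).card
      = ∑ i : ZMod n, if ekrArc k σ i ∈ 𝓕 then 1 else 0 := by
    intro σ; rw [ekrIdx, card_filter]
  simp_rw [h1]
  rw [sum_comm]
  have h2 : ∀ i : ZMod n, (∑ σ : ZMod n ≃ Ω, if ekrArc k σ i ∈ 𝓕 then 1 else 0)
      = ∑ A ∈ 𝓕, ekrCnt n k A := by
    intro i
    have : (∑ σ : ZMod n ≃ Ω, if ekrArc k σ i ∈ 𝓕 then 1 else 0)
      = ∑ σ : ZMod n ≃ Ω, if ekrArc k σ 0 ∈ 𝓕 then 1 else 0 := by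
      refine Fintype.sum_bijective (fun σ => (Equiv.addRight i).trans σ) ?_ _ _ ?_
      · constructor
        · intro σ τ h
          ext x
          have := congrArg (fun f => f (x - i)) h
          simpa using this
        · intro σ
          refine ⟨(Equiv.addRight i).symm.trans σ, ?_⟩
          ext x; simp
      · intro σ
        simp only [ekr_arc_shift]
    rw [this, ← card_filter]
    simp only [ekrCnt]
    rw [← card_biUnion]
    · congr 1; ext σ; simp
    · intro A _ B _ hAB
      rw [Function.onFun, disjoint_left]
      intro σ h h'
      simp only [mem_filter, mem_univ, true_and] at h h'
      exact hAB (h.symm.trans h')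
  simp [h2, ZMod.card]

theorem ekr_main_count (k : ℕ) (hn : Fintype.card Ω = n) (hk1 : 1 ≤ k) (hk : 2 * k ≤ n)
    (𝓕 : Finset (Finset Ω)) (hsize : ∀ A ∈ 𝓕, A.card = k)
    (hint : ∀ A ∈ 𝓕, ∀ B ∈ 𝓕, (A ∩ B).Nonempty) :
    𝓕.card ≤ (n - 1).choose (k - 1) ∧ (𝓕.card = (n - 1).choose (k - 1) →
      ∀ σ : ZMod n ≃ Ω, (ekrIdx k 𝓕 σ).card = k) := by
  have hn0 : 0 < n := by omega
  obtain ⟨σ0⟩ : Nonempty (ZMod n ≃ Ω) :=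
    ⟨Fintype.equivOfCardEq (by rw [ZMod.card, hn])⟩
  set c := ekrCnt n k (ekrArc k σ0 0) with hc
  have hcpos : 0 < c := by
    rw [hc, ekrCnt, card_pos]
    exact ⟨σ0, by simp⟩
  have hcA : ∀ A : Finset Ω, A.card = k → ekrCnt n k A = c := by
    intro A hA
    have : A.card = (ekrArc k σ0 0).card := by rw [hA, ekr_arc_card k (by omega)]
    exact le_antisymm (ekr_cnt_le k _ _ this) (ekr_cnt_le k _ _ this.symm)
  have hS := ekr_sum_idx (n := n) k 𝓕
  rw [sum_congr rfl (fun A hA => hcA A (hsize A hA)), sum_const, smul_eq_mul] at hS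
  have hT := ekr_sum_idx (n := n) k (powersetCard k (univ : Finset Ω))
  rw [sum_congr rfl (fun A hA => hcA A (mem_powersetCard.1 hA).2), sum_const, smul_eq_mul,
    card_powersetCard, card_univ, hn] at hT
  have hall : ∀ σ : ZMod n ≃ Ω, (ekrIdx k (powersetCard k (univ : Finset Ω)) σ).card = n := by
    intro σ
    have : ekrIdx k (powersetCard k (univ : Finset Ω)) σ = univ := by
      ext i; simp [ekrIdx, mem_powersetCard, ekr_arc_card k (by omega : k ≤ n)]
    rw [this, card_univ, ZMod.card]
  simp only [hall, sum_const, smul_eq_mul] at hT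
  set N := (univ : Finset (ZMod n ≃ Ω)).card
  have hN : N = n.choose k * c := by
    apply Nat.eq_of_mul_eq_mul_left hn0; rw [← hT]; ring
  have hch : n * (n - 1).choose (k - 1) = n.choose k * k := by
    have := Nat.add_one_mul_choose_eq (n - 1) (k - 1)
    rwa [Nat.sub_add_cancel hn0, Nat.sub_add_cancel hk1] at this
  have hle := fun σ : ZMod n ≃ Ω => ekr_idx_le k hk1 hk 𝓕 hint σ
  have hsum : ∑ σ : ZMod n ≃ Ω, k = n * ((n - 1).choose (k - 1) * c) := by
    rw [sum_const, smul_eq_mul]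
    change N * k = _
    rw [hN, ← mul_assoc, hch]; ring
  constructor
  · have h := sum_le_sum (fun σ (_ : σ ∈ (univ : Finset (ZMod n ≃ Ω))) => hle σ)
    rw [hS, hsum] at h
    exact Nat.le_of_mul_le_mul_right (Nat.le_of_mul_le_mul_left h hn0) hcpos
  · intro he σ
    have h := (sum_eq_sum_iff_of_le
      (fun σ (_ : σ ∈ (univ : Finset (ZMod n ≃ Ω))) => hle σ)).1 (by rw [hS, hsum, he])
    exact h σ (mem_univ _)

set_option maxHeartbeats 2000000 in
theorem ekr_order (k : ℕ) (hn : Fintype.card Ω = n) (hk : 2 * k < n)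
    (A S : Finset Ω) (a b : Ω) (hA : A.card = k) (hS : S.card = k) (haA : a ∈ A) (hbA : b ∉ A)
    (haS : a ∈ S) (hbS : b ∉ S) (hne : A ≠ S) :
    ∃ (σ : ZMod n ≃ Ω) (t : ℕ), 1 ≤ t ∧ t < k ∧ ekrArc k σ 0 = A ∧
      ekrArc k σ 1 = insert b (A.erase a) ∧ ekrArc k σ ((n - t : ℕ) : ZMod n) = S := by
  obtain ⟨t, ht⟩ : ∃ t, t = (S \ A).card := ⟨_, rfl⟩
  have hab : a ≠ b := fun h => hbA (h ▸ haA)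
  have hint : (A ∩ S).card + t = k := by
    rw [ht, ← hS, inter_comm]; exact card_inter_add_card_sdiff S A
  have hint2 : (A ∩ S).card + (A \ S).card = k := by
    rw [← hA]; exact card_inter_add_card_sdiff A S
  have hpos : 0 < (A ∩ S).card := card_pos.2 ⟨a, by simp [haA, haS]⟩
  have ht1 : 1 ≤ t := by
    rw [ht, Nat.one_le_iff_ne_zero, Ne, card_eq_zero, sdiff_eq_empty_iff_subset]
    intro h
    exact hne (eq_of_subset_of_card_le h (by omega)).symm
  have hun : (A ∪ S).card = k + t := by
    have := card_union_add_card_inter A S; omega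
  let c : Ω → Fin 6 := fun x => if x = a then 0 else if x = b then 3 else
    if x ∈ A then (if x ∈ S then 1 else 2) else if x ∈ S then 5 else 4
  let d : ZMod n → Fin 6 := fun y => if y.val = 0 then 0 else if y.val < k - t then 1 else
    if y.val < k then 2 else if y.val = k then 3 else if y.val < n - t then 4 else 5
  have hcd : ∀ j : Fin 6, (univ.filter (fun y => d y = j)).card
      = (univ.filter (fun x => c x = j)).card := by
    have D : ∀ (j : Fin 6) (l r : ℕ), r ≤ n → (∀ y : ZMod n, d y = j ↔ l ≤ y.val ∧ y.val < r) →
        (univ.filter (fun y => d y = j)).card = r - l := by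
      intro j l r hr h
      rw [← ekr_card_val (n := n) l r hr]
      congr 1; ext y; simp [h]
    have C : ∀ (j : Fin 6) (T : Finset Ω), (∀ x, c x = j ↔ x ∈ T) →
        (univ.filter (fun x => c x = j)).card = T.card := by
      intro j T h
      congr 1; ext y; simp [h]
    intro j
    fin_cases j
    · rw [D _ 0 1 (by omega), C _ {a}]
      · simp
      · intro x; simp only [c]; clear D C; split_ifs <;> simp_all
      · intro y; have := ZMod.val_lt y
        simp only [d]; clear D C; generalize y.val = m at *; split_ifs <;> simp <;> omega
    · rw [D _ 1 (k - t) (by omega), C _ ((A ∩ S).erase a)]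
      · rw [card_erase_of_mem (by simp [haA, haS])]; omega
      · intro x; simp only [c]; clear D C; split_ifs <;> simp_all
      · intro y; have := ZMod.val_lt y
        simp only [d]; clear D C; generalize y.val = m at *; split_ifs <;> simp <;> omega
    · rw [D _ (k - t) k (by omega), C _ (A \ S)]
      · omega
      · intro x; simp only [c]; clear D C; split_ifs <;> simp_all
      · intro y; have := ZMod.val_lt y
        simp only [d]; clear D C; generalize y.val = m at *; split_ifs <;> simp <;> omega
    · rw [D _ k (k + 1) (by omega), C _ {b}]
      · simp
      · intro x; simp only [c]; clear D C; split_ifs <;> simp_all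
      · intro y; have := ZMod.val_lt y
        simp only [d]; clear D C; generalize y.val = m at *; split_ifs <;> simp <;> omega
    · rw [D _ (k + 1) (n - t) (by omega), C _ (insert b (A ∪ S))ᶜ]
      · rw [card_compl, card_insert_of_notMem (by simp [hbA, hbS]), hn]; omega
      · intro x; simp only [c]; clear D C; split_ifs <;> simp_all
      · intro y; have := ZMod.val_lt y
        simp only [d]; clear D C; generalize y.val = m at *; split_ifs <;> simp <;> omega
    · rw [D _ (n - t) n (by omega), C _ (S \ A)]
      · omega
      · intro x; simp only [c]; clear D C; split_ifs <;> simp_all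
      · intro y; have := ZMod.val_lt y
        simp only [d]; clear D C; generalize y.val = m at *; split_ifs <;> simp <;> omega
  have he : ∀ j : Fin 6, Nonempty ({y // d y = j} ≃ {x // c x = j}) := by
    intro j
    refine ⟨Fintype.equivOfCardEq ?_⟩
    rw [Fintype.card_subtype, Fintype.card_subtype, hcd]
  let σ : ZMod n ≃ Ω := Equiv.ofFiberEquiv (fun j => (he j).some)
  have hσ : ∀ y, c (σ y) = d y := fun y => Equiv.ofFiberEquiv_map _ y
  have key : ∀ (i : ZMod n) (T : Finset Ω), (∀ y, (y - i).val < k ↔ σ y ∈ T) →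
      ekrArc k σ i = T := by
    intro i T h
    ext x
    have := h (σ.symm x)
    simpa [ekrArc] using this
  have hk1 : 1 < n := by omega
  have v1 : (1 : ZMod n).val = 1 := by
    have := ZMod.val_cast_of_lt (n := n) (a := 1) hk1
    simpa using this
  have vt : ((n - t : ℕ) : ZMod n).val = n - t := ZMod.val_cast_of_lt (by omega)
  refine ⟨σ, t, ht1, by omega, key _ _ ?_, key _ _ ?_, key _ _ ?_⟩
  · intro y
    have hy := ZMod.val_lt y
    have h := hσ y
    rw [sub_zero]
    have e : y.val < k ↔ (d y = 0 ∨ d y = 1 ∨ d y = 2) := by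
      simp only [d]; clear h; generalize y.val = m at *; split_ifs <;> simp <;> omega
    rw [e, ← h]
    simp only [c]; split_ifs <;> simp_all
  · intro y
    have hy := ZMod.val_lt y
    have hy' := ZMod.val_lt (y - 1)
    have h := hσ y
    have h1 := ekr_val_sub y 1
    have e : (y - 1).val < k ↔ (d y = 1 ∨ d y = 2 ∨ d y = 3) := by
      simp only [d]; clear h; generalize y.val = m at *; split_ifs <;> simp <;> omega
    rw [e, ← h]
    simp only [c]; split_ifs <;> simp_all
  · intro y
    have hy := ZMod.val_lt y
    have hy' := ZMod.val_lt (y - ((n - t : ℕ) : ZMod n))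
    have h := hσ y
    have h1 := ekr_val_sub y ((n - t : ℕ) : ZMod n)
    rw [vt] at h1
    have e : (y - ((n - t : ℕ) : ZMod n)).val < k ↔ (d y = 0 ∨ d y = 1 ∨ d y = 5) := by
      simp only [d]; clear h; generalize y.val = m at *; split_ifs <;> simp <;> omega
    rw [e, ← h]
    simp only [c]; split_ifs <;> simp_all

theorem ekr_key (k : ℕ) (hn : Fintype.card Ω = n) (hk1 : 1 ≤ k) (hk : 2 * k < n)
    (𝓕 : Finset (Finset Ω)) (hint : ∀ A ∈ 𝓕, ∀ B ∈ 𝓕, (A ∩ B).Nonempty)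
    (hall : ∀ σ : ZMod n ≃ Ω, (ekrIdx k 𝓕 σ).card = k)
    (A : Finset Ω) (a b : Ω) (hA : A.card = k) (haA : a ∈ A) (hbA : b ∉ A) (hAF : A ∈ 𝓕)
    (hB : insert b (A.erase a) ∉ 𝓕) (S : Finset Ω) (hS : S.card = k) (haS : a ∈ S)
    (hbS : b ∉ S) : S ∈ 𝓕 := by
  by_cases hne : A = S
  · rwa [← hne]
  obtain ⟨σ, t, ht1, htk, h0, h1, h2⟩ := ekr_order k hn hk A S a b hA hS haA hbA haS hbS hne
  rw [← h2]
  exact ekr_idx_eq k hk1 hk 𝓕 hint σ (hall σ) (by rwa [h0]) (by rwa [h1]) t ht1 htk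

theorem ekr_adj (k : ℕ) (𝓕 : Finset (Finset Ω)) (D : Finset Ω) (hD : D.card = k) (hDF : D ∉ 𝓕) :
    ∀ (m : ℕ) (A : Finset Ω), A.card = k → A ∈ 𝓕 → (A \ D).card = m →
      ∃ (A' : Finset Ω) (a b : Ω), A'.card = k ∧ A' ∈ 𝓕 ∧ a ∈ A' ∧ b ∉ A' ∧
        insert b (A'.erase a) ∉ 𝓕 := by
  intro m
  induction m with
  | zero =>
    intro A hA hAF h
    rw [card_eq_zero, sdiff_eq_empty_iff_subset] at h
    rw [eq_of_subset_of_card_le h (by omega)] at hAF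
    exact absurd hAF hDF
  | succ m ih =>
    intro A hA hAF h
    obtain ⟨a, ha⟩ : (A \ D).Nonempty := card_pos.1 (by omega)
    have h' : (D \ A).card = m + 1 := by
      have h1 := card_inter_add_card_sdiff D A
      have h2 := card_inter_add_card_sdiff A D
      rw [inter_comm] at h1; omega
    obtain ⟨b, hb⟩ : (D \ A).Nonempty := card_pos.1 (by omega)
    rw [mem_sdiff] at ha hb
    by_cases hB : insert b (A.erase a) ∈ 𝓕
    · refine ih _ ?_ hB ?_
      · rw [card_insert_of_notMem (by simp [hb.2]), card_erase_add_one ha.1, hA]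
      · have : insert b (A.erase a) \ D = (A \ D).erase a := by
          ext x; simp only [mem_sdiff, mem_insert, mem_erase]
          constructor
          · rintro ⟨rfl | h1, h2⟩
            · exact absurd hb.1 h2
            · exact ⟨h1.1, h1.2, h2⟩
          · rintro ⟨h1, h2, h3⟩
            exact ⟨Or.inr ⟨h1, h2⟩, h3⟩
        rw [this, card_erase_of_mem (mem_sdiff.2 ha), h]; rfl
    · exact ⟨A, a, b, hA, hAF, ha.1, hb.2, hB⟩

theorem ekr_star_card (k : ℕ) (hn : Fintype.card Ω = n) (hk1 : 1 ≤ k) (x : Ω) :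
    ((powersetCard k (univ : Finset Ω)).filter (fun A => x ∈ A)).card
      = (n - 1).choose (k - 1) := by
  have : (powersetCard (k - 1) ((univ : Finset Ω).erase x)).card = (n - 1).choose (k - 1) := by
    rw [card_powersetCard, card_erase_of_mem (mem_univ _), card_univ, hn]
  rw [← this]
  refine card_bij (fun A _ => A.erase x) ?_ ?_ ?_
  · intro A hA
    simp only [mem_filter, mem_powersetCard, subset_univ, true_and] at hA ⊢
    exact ⟨erase_subset_erase _ (subset_univ _), by rw [card_erase_of_mem hA.2, hA.1]⟩
  · intro A hA B hB h
    simp only [mem_filter] at hA hB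
    rw [← insert_erase hA.2, ← insert_erase hB.2]
    rw [h]
  · intro B hB
    simp only [mem_powersetCard] at hB
    have hx : x ∉ B := fun h => by simpa using hB.1 h
    refine ⟨insert x B, ?_, erase_insert hx⟩
    simp only [mem_filter, mem_powersetCard, subset_univ, true_and]
    exact ⟨by rw [card_insert_of_notMem hx, hB.2]; omega, mem_insert_self _ _⟩

theorem ekr_unique (k : ℕ) (hn : Fintype.card Ω = n) (hk1 : 1 ≤ k) (hk : 2 * k < n)
    (𝓕 : Finset (Finset Ω)) (hsize : ∀ A ∈ 𝓕, A.card = k)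
    (hint : ∀ A ∈ 𝓕, ∀ B ∈ 𝓕, (A ∩ B).Nonempty)
    (hc : 𝓕.card = (n - 1).choose (k - 1)) :
    ∃ x : Ω, 𝓕 = (powersetCard k univ).filter (fun A => x ∈ A) := by
  have hall := (ekr_main_count k hn hk1 hk.le 𝓕 hsize hint).2 hc
  have KEY := ekr_key k hn hk1 hk 𝓕 hint hall
  obtain ⟨A0, hA0⟩ : 𝓕.Nonempty := by
    rw [← card_pos, hc]; exact Nat.choose_pos (by omega)
  have pick : ∀ (x : Ω) (T : Finset Ω), x ∉ T → T.card + k ≤ n →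
      ∃ X : Finset Ω, X.card = k ∧ x ∈ X ∧ Disjoint X T := by
    intro x T hx hT
    obtain ⟨X, h1, h2, h3⟩ := exists_subsuperset_card_eq (s := {x}) (t := Tᶜ) (n := k)
      (by simpa using hx) (by simpa using hk1) (by rw [card_compl, hn]; omega)
    exact ⟨X, h3, by simpa using h1, by
      rw [disjoint_left]; intro y hy; simpa using h2 hy⟩
  obtain ⟨D, hD, hDF⟩ : ∃ D : Finset Ω, D.card = k ∧ D ∉ 𝓕 := by
    obtain ⟨D, h1, h2⟩ := exists_subset_card_eq (s := A0ᶜ) (n := k)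
      (by rw [card_compl, hn, hsize _ hA0]; omega)
    refine ⟨D, h2, fun h => ?_⟩
    obtain ⟨y, hy⟩ := hint _ h _ hA0
    rw [mem_inter] at hy
    have := h1 hy.1
    simp [hy.2] at this
  obtain ⟨A, a, b, hA, hAF, haA, hbA, hB⟩ := ekr_adj k 𝓕 D hD hDF _ A0 (hsize _ hA0) hA0 rfl
  have K1 := KEY A a b hA haA hbA hAF hB
  have hab : a ≠ b := fun h => hbA (h ▸ haA)
  refine ⟨a, (eq_of_subset_of_card_le ?_ ?_).symm⟩
  · intro S hS
    simp only [mem_filter, mem_powersetCard, subset_univ, true_and] at hS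
    by_contra hSF
    have hbS : b ∈ S := by
      by_contra hbS
      exact hSF (K1 S hS.1 hS.2 hbS)
    obtain ⟨d, hd⟩ : ∃ d, d ∉ S := by
      by_contra! h
      have : S = univ := by ext x; simp [h x]
      rw [this, card_univ] at hS; omega
    have hda : d ≠ a := fun h => hd (h ▸ hS.2)
    have hdb : d ≠ b := fun h => hd (h ▸ hbS)
    have hT : (insert d (S.erase b)).card = k := by
      rw [card_insert_of_notMem (by simp [hd]), card_erase_add_one hbS, hS.1]
    have hbT : b ∉ insert d (S.erase b) := by simp [hdb.symm]
    have hTF := K1 _ hT (by simp [hS.2, hab]) hbT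
    have K2 := KEY _ d b hT (mem_insert_self _ _) hbT hTF
      (by rw [erase_insert (by simp [hd]), insert_erase hbS]; exact hSF)
    obtain ⟨X, hX, haX, hXd⟩ := pick a {b, d} (by simp [hab, hda.symm])
      (by rw [card_pair hdb.symm]; omega)
    have hXb : b ∉ X := fun h => by simpa using disjoint_left.1 hXd h
    have hXd' : d ∉ X := fun h => by simpa using disjoint_left.1 hXd h
    obtain ⟨Y, hY, hdY, hYd⟩ := pick d (insert b X) (by simp [hdb, hXd'])
      (by rw [card_insert_of_notMem hXb]; omega)
    have hYb : b ∉ Y := fun h => by simpa using disjoint_left.1 hYd h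
    obtain ⟨z, hz⟩ := hint _ (K1 X hX haX hXb) _ (K2 Y hY hdY hYb)
    rw [mem_inter] at hz
    exact disjoint_left.1 hYd hz.2 (mem_insert_of_mem hz.1)
  · rw [ekr_star_card k hn hk1, hc]

end

/-- **Erdős–Ko–Rado theorem.** Let `Ω` be a finite set with `n` elements and `k ≤ n/2` a
positive integer. If `𝓕` is a family of `k`-element subsets of `Ω` any two of which have
nonempty intersection, then `|𝓕| ≤ C(n-1, k-1)`; moreover, if `n ≥ 2k+1`, equality holds
iff `𝓕` consists of all `k`-subsets containing some fixed element. -/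
theorem ekr_sets {Ω : Type*} [Fintype Ω] [DecidableEq Ω] (n k : ℕ)
    (hn : Fintype.card Ω = n) (hk : 1 ≤ k) (hk2 : k ≤ n / 2)
    (𝓕 : Finset (Finset Ω))
    (hsize : ∀ A ∈ 𝓕, A.card = k)
    (hint : ∀ A ∈ 𝓕, ∀ B ∈ 𝓕, (A ∩ B).Nonempty) :
    𝓕.card ≤ (n - 1).choose (k - 1) ∧
      (2 * k + 1 ≤ n →
        (𝓕.card = (n - 1).choose (k - 1) ↔
          ∃ x : Ω, 𝓕 = (Finset.powersetCard k Finset.univ).filter (fun A => x ∈ A))) := by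
  have hn0 : NeZero n := ⟨by omega⟩
  refine ⟨(ekr_main_count k hn hk (by omega) 𝓕 hsize hint).1, fun h => ⟨fun hc => ?_, ?_⟩⟩
  · exact ekr_unique k hn hk (by omega) 𝓕 hsize hint hc
  · rintro ⟨x, rfl⟩
    exact ekr_star_card k hn hk x
end

section
/- Let Ω be a finite set with |Ω| = n and let k and t be integers with 1 ≤ t < k. If n > (t+1)(k−t+1) and 𝓕 is a t-intersecting family of k-element subsets of Ω, then |𝓕| ≤ C(n−t, k−t), and equality holds if and only if 𝓕 consists of all k-element subsets of Ω containing some fixed t-element subset of Ω. -/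
section
open Finset

def TI {Ω : Type*} [DecidableEq Ω] (t : ℕ) (V : Finset (Finset Ω)) : Prop :=
  ∀ A ∈ V, ∀ B ∈ V, t ≤ (A ∩ B).card

def mv {Ω : Type*} [DecidableEq Ω] (x z : Ω) (A : Finset Ω) : Finset Ω := insert x (A.erase z)

def phi {Ω : Type*} [DecidableEq Ω] (x z : Ω) (V : Finset (Finset Ω)) (A : Finset Ω) : Finset Ω :=
  if x ∉ A ∧ z ∈ A ∧ mv x z A ∉ V then mv x z A else A

def shf {Ω : Type*} [DecidableEq Ω] (x z : Ω) (V : Finset (Finset Ω)) : Finset (Finset Ω) :=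
  V.image (phi x z V)

def stF (Ω : Type*) [DecidableEq Ω] [Fintype Ω] (k : ℕ) (T : Finset Ω) : Finset (Finset Ω) :=
  (Finset.powersetCard k Finset.univ).filter (fun A => T ⊆ A)

section
variable {Ω : Type*} [DecidableEq Ω]

lemma mv_card {x z : Ω} {A : Finset Ω} (hx : x ∉ A) (hz : z ∈ A) : (mv x z A).card = A.card := by
  unfold mv
  rw [card_insert_of_notMem (by simp [hx]), card_erase_of_mem hz]
  have := card_pos.2 ⟨z, hz⟩
  omega

lemma phi_card (x z : Ω) (V) (A : Finset Ω) : (phi x z V A).card = A.card := by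
  unfold phi
  split_ifs with h
  · exact mv_card h.1 h.2.1
  · rfl

lemma mv_inj {x z : Ω} {A B : Finset Ω} (hx : x ∉ A) (hz : z ∈ A) (hx' : x ∉ B) (hz' : z ∈ B)
    (h : mv x z A = mv x z B) : A = B := by
  have key : ∀ C : Finset Ω, x ∉ C → z ∈ C → insert z ((mv x z C).erase x) = C := by
    intro C h1 h2
    unfold mv
    rw [erase_insert (by simp [h1]), insert_erase h2]
  rw [← key A hx hz, h, key B hx' hz']

lemma phi_injOn (x z : Ω) (V : Finset (Finset Ω)) : Set.InjOn (phi x z V) V := by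
  intro A hA B hB h
  have hA : A ∈ V := hA
  have hB : B ∈ V := hB
  unfold phi at h
  split_ifs at h with h1 h2 h2
  · exact mv_inj h1.1 h1.2.1 h2.1 h2.2.1 h
  · rw [h] at h1; exact absurd hB h1.2.2
  · rw [← h] at h2; exact absurd hA h2.2.2
  · exact h

lemma shf_card (x z : Ω) (V : Finset (Finset Ω)) : (shf x z V).card = V.card :=
  card_image_of_injOn (phi_injOn x z V)

lemma mv_inter_of_notMem {x z : Ω} {A B : Finset Ω} (hx : x ∉ B) :
    mv x z A ∩ B = (A ∩ B).erase z := by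
  unfold mv; ext y; simp only [mem_inter, mem_insert, mem_erase]
  by_cases h : y = x
  · subst h; simp [hx]
  · simp [h, and_assoc]

lemma TI_aux {x z : Ω} {t : ℕ} {V : Finset (Finset Ω)} (hV : TI t V)
    {A B : Finset Ω} (hA : A ∈ V) (hB : B ∈ V)
    (h1 : x ∉ A ∧ z ∈ A ∧ mv x z A ∉ V) (h2 : ¬ (x ∉ B ∧ z ∈ B ∧ mv x z B ∉ V)) :
    t ≤ (mv x z A ∩ B).card := by
  obtain ⟨hx, hz, hm⟩ := h1
  by_cases hxB : x ∈ B
  · have : mv x z A ∩ B = insert x ((A ∩ B).erase z) := by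
      unfold mv; ext y; simp only [mem_inter, mem_insert, mem_erase]
      by_cases h : y = x
      · subst h; simp [hxB]
      · simp [h, and_assoc]
    rw [this, card_insert_of_notMem (by simp [hx])]
    have := hV A hA B hB
    have := pred_card_le_card_erase (s := A ∩ B) (a := z)
    omega
  · by_cases hzB : z ∈ B
    · have hB' : mv x z B ∈ V := by
        by_contra h; exact h2 ⟨hxB, hzB, h⟩
      have h3 := hV _ hB' A hA
      rw [mv_inter_of_notMem hx] at h3
      rw [mv_inter_of_notMem hxB, inter_comm]; exact h3
    · rw [mv_inter_of_notMem hxB, erase_eq_of_notMem (by simp [hzB])]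
      exact hV A hA B hB

lemma shf_TI {x z : Ω} {t : ℕ} {V : Finset (Finset Ω)} (hV : TI t V) : TI t (shf x z V) := by
  intro A' hA' B' hB'
  obtain ⟨A, hA, rfl⟩ := mem_image.1 hA'
  obtain ⟨B, hB, rfl⟩ := mem_image.1 hB'
  unfold phi
  split_ifs with h1 h2 h2
  · have : mv x z A ∩ mv x z B = insert x ((A ∩ B).erase z) := by
      unfold mv; ext y; simp only [mem_inter, mem_insert, mem_erase]
      tauto
    rw [this, card_insert_of_notMem (by simp [h1.1])]
    have := hV A hA B hB
    have := pred_card_le_card_erase (s := A ∩ B) (a := z)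
    omega
  · exact TI_aux hV hA hB h1 h2
  · rw [inter_comm]; exact TI_aux hV hB hA h2 h1
  · exact hV A hA B hB

/-- weight -/
def wt (p : Ω → ℕ) (V : Finset (Finset Ω)) : ℕ := ∑ A ∈ V, ∑ a ∈ A, p a

lemma wt_shf_lt {p : Ω → ℕ} {x z : Ω} (hp : p x < p z) {V : Finset (Finset Ω)} {A : Finset Ω}
    (hA : A ∈ V) (hx : x ∉ A) (hz : z ∈ A) (hm : mv x z A ∉ V) : wt p (shf x z V) < wt p V := by
  unfold wt shf
  rw [sum_image (phi_injOn x z V)]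
  have key : ∀ B : Finset Ω, x ∉ B → z ∈ B → ∑ a ∈ mv x z B, p a < ∑ a ∈ B, p a := by
    intro B h1 h2
    unfold mv
    rw [sum_insert (by simp [h1]), ← add_sum_erase B p h2]
    omega
  refine sum_lt_sum ?_ ⟨A, hA, ?_⟩
  · intro B hB
    unfold phi
    split_ifs with h
    · exact (key B h.1 h.2.1).le
    · exact le_rfl
  · unfold phi
    rw [if_pos ⟨hx, hz, hm⟩]
    exact key A hx hz

def Stab (p : Ω → ℕ) (V : Finset (Finset Ω)) : Prop :=
  ∀ A ∈ V, ∀ x z, x ∉ A → z ∈ A → p x < p z → mv x z A ∈ V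

variable [Fintype Ω]

lemma mem_stF {k : ℕ} {T A : Finset Ω} : A ∈ stF Ω k T ↔ A.card = k ∧ T ⊆ A := by
  simp [stF]

lemma stF_TI {k t : ℕ} {T : Finset Ω} (hT : T.card = t) : TI t (stF Ω k T) := by
  intro A hA B hB
  rw [← hT]
  exact card_le_card (subset_inter (mem_stF.1 hA).2 (mem_stF.1 hB).2)

/-- fibre count -/
lemma fib_card (k : ℕ) (I E : Finset Ω) (hE : E ⊆ I) (hk : E.card ≤ k) :
    ((univ : Finset (Finset Ω)).filter (fun A => A.card = k ∧ A ∩ I = E)).card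
      = (Fintype.card Ω - I.card).choose (k - E.card) := by
  rw [← card_compl, ← card_powersetCard]
  symm
  refine card_bij (fun C _ => E ∪ C) ?_ ?_ ?_
  · intro C hC
    rw [mem_powersetCard] at hC
    have hd : Disjoint I C := by
      rw [disjoint_right]; intro a ha; exact mem_compl.1 (hC.1 ha)
    simp only [mem_filter, mem_univ, true_and]
    constructor
    · rw [card_union_of_disjoint (hd.mono_left hE)]; omega
    · rw [union_inter_distrib_right, inter_eq_left.2 hE, disjoint_iff_inter_eq_empty.1 hd.symm, union_empty]
  · intro C hC D hD h
    rw [mem_powersetCard] at hC hD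
    have key : ∀ C : Finset Ω, C ⊆ Iᶜ → (E ∪ C) \ I = C := by
      intro C hC
      ext a
      have := @hC a
      have := @hE a
      simp only [mem_sdiff, mem_union, mem_compl] at *
      tauto
    rw [← key C hC.1, ← key D hD.1]; exact congrArg (· \ I) h
  · intro A hA
    simp only [mem_filter, mem_univ, true_and] at hA
    refine ⟨A \ I, ?_, ?_⟩
    · rw [mem_powersetCard]
      constructor
      · intro a; simp
      · have := card_sdiff_add_card_inter A I
        rw [hA.2] at this; omega
    · rw [← hA.2]; ext a; simp only [mem_union, mem_inter, mem_sdiff]; tauto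

lemma stF_card {k t : ℕ} {T : Finset Ω} (hT : T.card = t) (htk : t ≤ k) :
    (stF Ω k T).card = (Fintype.card Ω - t).choose (k - t) := by
  rw [← hT, ← fib_card k T T le_rfl (by omega)]
  congr 1
  ext A
  simp [mem_stF, inter_eq_right]

lemma fibs_card (k : ℕ) (I : Finset Ω) (R : Finset (Finset Ω)) (hE : ∀ E ∈ R, E ⊆ I)
    (hk : ∀ E ∈ R, E.card ≤ k) :
    ((univ : Finset (Finset Ω)).filter (fun A => A.card = k ∧ A ∩ I ∈ R)).card
      = ∑ E ∈ R, (Fintype.card Ω - I.card).choose (k - E.card) := by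
  rw [card_eq_sum_card_fiberwise (f := fun A => A ∩ I) (t := R)]
  · refine sum_congr rfl fun E h => ?_
    rw [← fib_card k I E (hE E h) (hk E h)]
    congr 1
    ext A
    simp only [mem_filter, mem_univ, true_and]
    constructor
    · rintro ⟨⟨h1, h2⟩, h3⟩; exact ⟨h1, h3⟩
    · rintro ⟨h1, h3⟩; exact ⟨⟨h1, h3 ▸ h⟩, h3⟩
  · intro A hA
    simp at hA
    exact hA.2

/-- uncompression -/
lemma unshift {k t : ℕ} (htk : t < k) (hn : 2 * k - t + 2 ≤ Fintype.card Ω)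
    {F : Finset (Finset Ω)} (hF : ∀ A ∈ F, A.card = k) (hTI : TI t F) {x z : Ω} (hxz : x ≠ z)
    {T : Finset Ω} (hT : T.card = t) (hs : shf x z F = stF Ω k T) :
    ∃ T' : Finset Ω, T'.card = t ∧ F = stF Ω k T' := by
  have hcard : F.card = (stF Ω k T).card := by rw [← hs, shf_card]
  suffices h : ∃ T' : Finset Ω, T'.card = t ∧ ∀ A ∈ F, T' ⊆ A by
    obtain ⟨T', h1, h2⟩ := h
    refine ⟨T', h1, eq_of_subset_of_card_le (fun A hA => mem_stF.2 ⟨hF A hA, h2 A hA⟩) ?_⟩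
    rw [hcard, stF_card h1 htk.le, stF_card hT htk.le]
  have hph : ∀ A ∈ F, T ⊆ phi x z F A := fun A hA =>
    (mem_stF.1 (hs ▸ mem_image_of_mem _ hA : phi x z F A ∈ stF Ω k T)).2
  by_cases hzT : z ∈ T
  · refine ⟨T, hT, fun A hA => ?_⟩
    have := hph A hA
    unfold phi at this
    split_ifs at this with h
    · have := this hzT
      simp [mv, hxz.symm] at this
    · exact this
  by_cases hxT : x ∉ T
  · refine ⟨T, hT, fun A hA => ?_⟩
    have := hph A hA
    unfold phi at this
    split_ifs at this with h
    · intro a ha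
      have h2 := this ha
      simp only [mv, mem_insert, mem_erase] at h2
      rcases h2 with h2 | h2
      · exact absurd (h2 ▸ ha) hxT
      · exact h2.2
    · exact this
  push Not at hxT
  set T2 := insert z (T.erase x) with hT2
  have hT2c : T2.card = t := by
    have := mv_card (x := z) (z := x) hzT hxT
    unfold mv at this; rw [hT2, this, hT]
  have hor : ∀ A ∈ F, T ⊆ A ∨ (x ∉ A ∧ T2 ⊆ A) := by
    intro A hA
    have := hph A hA
    unfold phi at this
    split_ifs at this with h
    · right
      refine ⟨h.1, ?_⟩
      intro a ha
      simp only [hT2, mem_insert, mem_erase] at ha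
      rcases ha with rfl | ha
      · exact h.2.1
      · have := this ha.2
        simp only [mv, mem_insert, mem_erase] at this
        tauto
    · left; exact this
  by_contra hcon
  push Not at hcon
  obtain ⟨A0, hA0, hA0T⟩ := hcon T hT
  obtain ⟨B0, hB0, hB0T⟩ := hcon T2 hT2c
  have hA0' := (hor A0 hA0).resolve_left hA0T
  have hB0' : T ⊆ B0 := (hor B0 hB0).resolve_right (fun h => hB0T h.2)
  have hzB0 : z ∉ B0 := by
    intro h; apply hB0T; intro a ha
    simp only [hT2, mem_insert, mem_erase] at ha
    rcases ha with rfl | ha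
    · exact h
    · exact hB0' ha.2
  set W := (insert z T)ᶜ with hW
  have hWc : W.card = Fintype.card Ω - (t + 1) := by
    rw [hW, card_compl, card_insert_of_notMem hzT, hT]
  have hab : ∀ C ⊆ W, C.card = k - t → T ∪ C ∈ F ∨ T2 ∪ C ∈ F := by
    intro C hC hCc
    have hd : Disjoint T C := by
      rw [disjoint_right]; intro a ha h; have := hC ha
      simp [hW, h] at this
    have : T ∪ C ∈ shf x z F := by
      rw [hs, mem_stF, card_union_of_disjoint hd]
      exact ⟨by omega, subset_union_left⟩
    obtain ⟨A, hA, hAe⟩ := mem_image.1 this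
    unfold phi at hAe
    split_ifs at hAe with h
    · right
      have : T2 ∪ C = A := by
        have hzC : z ∉ C := fun h => by have := hC h; simp [hW] at this
        have hxC : x ∉ C := fun h => by have := hC h; simp [hW, hxT] at this
        have e : insert z ((mv x z A).erase x) = A := by
          unfold mv
          rw [erase_insert (by simp [h.1]), insert_erase h.2.1]
        rw [← e, hAe, hT2]
        ext a
        simp only [mem_union, mem_insert, mem_erase]
        by_cases hax : a = x
        · subst hax; simp [hxC]
        · tauto
      rw [this]; exact hA
    · left; rw [← hAe]; exact hA
  have hno : ∀ C ⊆ W, ∀ D ⊆ W, Disjoint C D → T ∪ C ∈ F → T2 ∪ D ∈ F → False := by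
    intro C hC D hD hd h1 h2
    have h3 := hTI _ h1 _ h2
    have : (T ∪ C) ∩ (T2 ∪ D) ⊆ T.erase x := by
      intro a ha
      have e1 := @hC a
      have e2 := @hD a
      have e3 : a ∈ C → a ∉ D := fun h => disjoint_left.1 hd h
      simp only [hW, hT2, mem_inter, mem_union, mem_insert, mem_erase, mem_compl] at *
      grind
    have := card_le_card this
    rw [card_erase_of_mem hxT] at this
    have := card_pos.2 ⟨x, hxT⟩
    omega
  have hext : ∀ C ⊆ W, C.card ≤ k - t + 1 → ∃ E ⊆ W, E.card = k - t ∧ Disjoint C E := by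
    intro C hC hCc
    have : k - t ≤ (W \ C).card := by
      rw [card_sdiff_of_subset hC]; omega
    obtain ⟨E, hE, hEc⟩ := exists_subset_card_eq this
    exact ⟨E, hE.trans sdiff_subset, hEc, disjoint_of_subset_right hE disjoint_sdiff⟩
  set D0 := A0 \ T2 with hD0
  have hD0e : T2 ∪ D0 = A0 := union_sdiff_of_subset hA0'.2
  have hD0c : D0.card = k - t := by
    rw [hD0, card_sdiff_of_subset hA0'.2, hF A0 hA0, hT2c]
  have hD0W : D0 ⊆ W := by
    intro a ha
    have := hA0'.1
    simp only [hD0, hT2, hW, mem_sdiff, mem_insert, mem_erase, mem_compl] at *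
    grind
  have main : ∀ r : ℕ, ∀ C ⊆ W, C.card = k - t → (D0 \ C).card = r → T ∪ C ∈ F → False := by
    intro r
    induction r with
    | zero =>
      intro C hC hCc hr hCF
      have hsub : D0 ⊆ C := by
        rw [card_eq_zero, sdiff_eq_empty_iff_subset] at hr; exact hr
      have : D0 = C := eq_of_subset_of_card_le hsub (by omega)
      obtain ⟨E, hE, hEc, hd⟩ := hext C hC (by omega)
      rcases hab E hE hEc with h | h
      · exact hno E hE D0 hD0W (this ▸ hd.symm) h (hD0e ▸ hA0)
      · exact hno C hC E hE hd hCF h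
    | succ r ih =>
      intro C hC hCc hr hCF
      obtain ⟨v, hv⟩ : (D0 \ C).Nonempty := by rw [← card_pos]; omega
      obtain ⟨u, hu⟩ : (C \ D0).Nonempty := by
        rw [← card_pos]
        have h1 := card_sdiff_add_card_inter C D0
        have h2 := card_sdiff_add_card_inter D0 C
        rw [inter_comm] at h2
        omega
      rw [mem_sdiff] at hu hv
      have hinsW : insert v C ⊆ W := insert_subset (hD0W hv.1) hC
      obtain ⟨E, hE, hEc, hd⟩ := hext (insert v C) hinsW
        ((card_insert_le _ _).trans (by omega))
      have hsub : mv v u C ⊆ insert v C := insert_subset_insert _ (erase_subset _ _)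
      have hEF : T ∪ E ∈ F := (hab E hE hEc).resolve_right
        fun h => hno C hC E hE (disjoint_of_subset_left (subset_insert _ _) hd) hCF h
      have hmc : (mv v u C).card = k - t := by rw [mv_card hv.2 hu.1, hCc]
      refine ih (mv v u C) (hsub.trans hinsW) hmc ?_ ?_
      · have : D0 \ mv v u C = (D0 \ C).erase v := by
          unfold mv
          ext a
          simp only [mem_sdiff, mem_insert, mem_erase]
          grind
        rw [this, card_erase_of_mem (mem_sdiff.2 hv)]; omega
      · exact (hab _ (hsub.trans hinsW) hmc).resolve_right
          fun h => hno E hE _ (hsub.trans hinsW) (disjoint_of_subset_left hsub hd).symm hEF h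
  refine main _ (B0 \ T) ?_ ?_ rfl ?_
  · intro a ha
    simp only [hW, mem_sdiff, mem_compl, mem_insert] at *
    grind
  · rw [card_sdiff_of_subset hB0', hF B0 hB0, hT]
  · rw [union_sdiff_of_subset hB0']; exact hB0


def Mx (k t : ℕ) (F : Finset (Finset Ω)) : Prop :=
  (∀ A ∈ F, A.card = k) ∧ TI t F ∧
    ∀ F' : Finset (Finset Ω), (∀ A ∈ F', A.card = k) → TI t F' → F'.card ≤ F.card

def Bd (V : Finset (Finset Ω)) (I : Finset Ω) (z : Ω) : Finset (Finset Ω) :=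
  V.filter (fun D => D ⊆ I ∧ z ∈ D ∧ D.erase z ∉ V)

set_option linter.unusedSectionVars false in
lemma mem_Bd {V : Finset (Finset Ω)} {I D : Finset Ω} {z : Ω} :
    D ∈ Bd V I z ↔ D ∈ V ∧ D ⊆ I ∧ z ∈ D ∧ D.erase z ∉ V := by
  simp [Bd]

lemma keyP {p : Ω → ℕ} {t : ℕ} {V : Finset (Finset Ω)} (hTI : TI t V) (hst : Stab p V)
    {I : Finset Ω} {z : Ω} (hlt : ∀ l ∈ I, l ≠ z → p l < p z)
    (hI : ∀ A ∈ V, A ∩ I ∈ V) {A E : Finset Ω} (hA : A ∈ V) (hE : E ∈ Bd V I z)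
    (h : (A ∩ E.erase z).card < t) :
    A ∩ I ∈ Bd V I z ∧ (A ∩ I) ∪ E = I ∧ ((A ∩ I) ∩ E).card = t := by
  obtain ⟨hEV, hEI, hzE, hEe⟩ := mem_Bd.1 hE
  have e1 : (A ∩ I) ∩ E = A ∩ E := by
    rw [inter_assoc, inter_eq_right.2 hEI]
  have e2 : A ∩ E.erase z = (A ∩ E).erase z := by
    ext a; simp only [mem_inter, mem_erase]; tauto
  have h1 := hTI A hA E hEV
  have hz : z ∈ A := by
    by_contra hz
    rw [e2, erase_eq_of_notMem (by simp [hz])] at h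
    omega
  have hzI : z ∈ I := hEI hzE
  have h2 : (A ∩ E).card = t := by
    rw [e2, card_erase_of_mem (by simp [hz, hzE])] at h
    omega
  refine ⟨mem_Bd.2 ⟨hI A hA, inter_subset_right, by simp [hz, hzI], ?_⟩, ?_, by rw [e1, h2]⟩
  · intro hm
    have h3 := hTI _ hm E hEV
    have : (A ∩ I).erase z ∩ E ⊆ A ∩ E.erase z := by
      intro a; simp only [mem_inter, mem_erase]; tauto
    have := card_le_card this
    omega
  · refine subset_antisymm (union_subset inter_subset_right hEI) ?_
    intro l hl
    by_contra hc
    simp only [mem_union, mem_inter, not_or, not_and] at hc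
    have hlz : l ≠ z := fun h => hc.2 (h ▸ hzE)
    have h4 := hst E hEV l z hc.2 hzE (hlt l hl hlz)
    have h5 := hTI _ (hI A hA) _ h4
    have : (A ∩ I) ∩ mv l z E ⊆ A ∩ E.erase z := by
      intro a; simp only [mv, mem_inter, mem_insert, mem_erase]; grind
    have := card_le_card this
    omega

lemma swap {p : Ω → ℕ} {k t : ℕ} {F V : Finset (Finset Ω)} (hF : Mx k t F)
    (hVk : ∀ A ∈ V, A.card ≤ k) (hTI : TI t V) (hVF : V.filter (fun A => A.card = k) = F)
    (hVm : ∀ V' : Finset (Finset Ω), (∀ A ∈ V', A.card ≤ k) → TI t V' →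
      V'.filter (fun A => A.card = k) = F → V'.card ≤ V.card)
    (hst : Stab p V)
    {I : Finset Ω} {z : Ω} (hlt : ∀ l ∈ I, l ≠ z → p l < p z)
    (hI : ∀ A ∈ V, A ∩ I ∈ V) {S R : Finset (Finset Ω)} (hS : S ⊆ Bd V I z) (hR : R ⊆ Bd V I z)
    (hd : ∀ E ∈ S, E ∉ R)
    (hSR : ∀ E ∈ S, ∀ D ∈ Bd V I z, D ∉ R → D ∪ E = I → (D ∩ E).card = t → False) :
    (∑ E ∈ S, (Fintype.card Ω - I.card).choose (k - E.card + 1) ≤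
      ∑ D ∈ R, (Fintype.card Ω - I.card).choose (k - D.card)) ∧ (R = ∅ → S = ∅) := by
  set S' := S.image (fun E => E.erase z) with hS'
  set V1 := V.filter (fun A => A ∩ I ∉ R) ∪
    univ.filter (fun A => A.card ≤ k ∧ A ∩ I ∈ S') with hV1
  have hk1 : ∀ A ∈ V1, A.card ≤ k := by
    intro A hA
    simp only [hV1, mem_union, mem_filter, mem_univ, true_and] at hA
    rcases hA with hA | hA
    · exact hVk A hA.1
    · exact hA.1
  have hS'V : ∀ A ∈ S', A ∉ V := by
    intro A hA
    obtain ⟨E, hE, rfl⟩ := mem_image.1 hA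
    exact (mem_Bd.1 (hS hE)).2.2.2
  have aux : ∀ A ∈ V, A ∩ I ∉ R → ∀ E ∈ S, t ≤ (A ∩ E.erase z).card := by
    intro A hA hAR E hE
    by_contra hc
    push Not at hc
    obtain ⟨h1, h2, h3⟩ := keyP hTI hst hlt hI hA (hS hE) hc
    exact hSR E hE _ h1 hAR h2 h3
  have aux2 : ∀ A ∈ V, A ∩ I ∉ R → ∀ B : Finset Ω, B ∩ I ∈ S' → t ≤ (A ∩ B).card := by
    intro A hA hAR B hB
    obtain ⟨E, hE, hEB⟩ := mem_image.1 hB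
    refine (aux A hA hAR E hE).trans (card_le_card (inter_subset_inter_left ?_))
    rw [hEB]; exact inter_subset_left
  have hTI1 : TI t V1 := by
    intro A hA B hB
    simp only [hV1, mem_union, mem_filter, mem_univ, true_and] at hA hB
    rcases hA with hA | hA <;> rcases hB with hB | hB
    · exact hTI A hA.1 B hB.1
    · exact aux2 A hA.1 hA.2 B hB.2
    · rw [inter_comm]; exact aux2 B hB.1 hB.2 A hA.2
    · obtain ⟨E, hE, hEA⟩ := mem_image.1 hA.2
      have hEB := mem_Bd.1 (hS hE)
      have h1 := aux2 E hEB.1 (by rw [inter_eq_left.2 hEB.2.1]; exact hd E hE) (B ∩ I)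
        (by rw [inter_assoc, inter_self]; exact hB.2)
      obtain ⟨E2, hE2, hEB2⟩ := mem_image.1 hB.2
      refine h1.trans (card_le_card ?_)
      intro a ha
      have h6 : a ∈ E2.erase z := by rw [hEB2]; exact (mem_inter.1 ha).2
      have h7 : a ∈ A ∩ I := by
        rw [← hEA]; exact mem_erase.2 ⟨(mem_erase.1 h6).1, (mem_inter.1 ha).1⟩
      exact mem_inter.2 ⟨(mem_inter.1 h7).1, (mem_inter.1 (mem_inter.1 ha).2).1⟩
  have hmax := hF.2.2 (V1.filter (fun A => A.card = k)) (fun A hA => (mem_filter.1 hA).2)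
    (fun A hA B hB => hTI1 A (mem_filter.1 hA).1 B (mem_filter.1 hB).1)
  constructor
  · set X := (univ : Finset (Finset Ω)).filter (fun A => A.card = k ∧ A ∩ I ∈ R) with hX
    set Y := (univ : Finset (Finset Ω)).filter (fun A => A.card = k ∧ A ∩ I ∈ S') with hY
    have hXc : X.card = ∑ D ∈ R, (Fintype.card Ω - I.card).choose (k - D.card) :=
      fibs_card k I R (fun E hE => (mem_Bd.1 (hR hE)).2.1) (fun E hE => hVk E (mem_Bd.1 (hR hE)).1)
    have hYc : Y.card = ∑ E ∈ S, (Fintype.card Ω - I.card).choose (k - E.card + 1) := by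
      rw [hY, fibs_card k I S', hS', sum_image]
      · refine sum_congr rfl fun E hE => ?_
        have hEB := mem_Bd.1 (hS hE)
        have := hVk E hEB.1
        have := card_pos.2 ⟨z, hEB.2.2.1⟩
        rw [card_erase_of_mem hEB.2.2.1]
        congr 1; omega
      · intro E hE E2 hE2 h
        have h1 := (mem_Bd.1 (hS hE)).2.2.1
        have h2 := (mem_Bd.1 (hS hE2)).2.2.1
        simp only at h
        rw [← insert_erase h1, h, insert_erase h2]
      · intro A hA
        obtain ⟨E, hE, rfl⟩ := mem_image.1 hA
        exact (erase_subset _ _).trans (mem_Bd.1 (hS hE)).2.1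
      · intro A hA
        obtain ⟨E, hE, rfl⟩ := mem_image.1 hA
        exact (card_le_card (erase_subset _ _)).trans (hVk E (mem_Bd.1 (hS hE)).1)
    rw [← hXc, ← hYc]
    have hsub : (F \ X) ∪ Y ⊆ V1.filter (fun A => A.card = k) := by
      intro A hA
      simp only [mem_union, mem_sdiff, hX, hY, hV1, mem_filter, mem_univ, true_and] at hA ⊢
      rcases hA with ⟨h1, h2⟩ | hA
      · rw [← hVF, mem_filter] at h1
        exact ⟨Or.inl ⟨h1.1, fun h => h2 ⟨h1.2, h⟩⟩, h1.2⟩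
      · exact ⟨Or.inr ⟨hA.1.le, hA.2⟩, hA.1⟩
    have hdis : Disjoint (F \ X) Y := by
      rw [disjoint_left]
      intro A hA hAY
      rw [mem_sdiff, ← hVF, mem_filter] at hA
      rw [hY, mem_filter] at hAY
      exact hS'V _ hAY.2.2 (hI A hA.1.1)
    have h1 := (card_le_card hsub).trans hmax
    rw [card_union_of_disjoint hdis] at h1
    have h2 := le_card_sdiff X F
    omega
  · intro hRe
    by_contra hSe
    obtain ⟨E, hE⟩ := nonempty_iff_ne_empty.2 hSe
    have hsub : V ⊆ V1 := by
      intro A hA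
      rw [hV1, mem_union, mem_filter]
      left; exact ⟨hA, by simp [hRe]⟩
    have hEB := mem_Bd.1 (hS hE)
    have hEV1 : E.erase z ∈ V1 := by
      rw [hV1, mem_union, mem_filter, mem_filter]
      right
      refine ⟨mem_univ _, (card_le_card (erase_subset _ _)).trans (hVk E hEB.1), ?_⟩
      rw [inter_eq_left.2 ((erase_subset _ _).trans hEB.2.1)]
      exact mem_image_of_mem _ hE
    have hFV1 : V1.filter (fun A => A.card = k) = F := by
      symm
      refine eq_of_subset_of_card_le ?_ hmax
      rw [← hVF]; exact filter_subset_filter _ hsub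
    have h1 := hVm V1 hk1 hTI1 hFV1
    have h2 := eq_of_subset_of_card_le hsub h1
    exact hEB.2.2.2 (h2 ▸ hEV1)

lemma choose_ineq {N a b : ℕ} (h : a + b + 1 < N) {x y : ℕ} (hx : 0 < x) (hy : 0 < y)
    (h1 : x * N.choose (a + 1) ≤ y * N.choose b) (h2 : y * N.choose (b + 1) ≤ x * N.choose a) :
    False := by
  have e1 := Nat.choose_succ_right_eq N a
  have e2 := Nat.choose_succ_right_eq N b
  have p1 : 0 < N.choose a := Nat.choose_pos (by omega)
  have p2 : 0 < N.choose b := Nat.choose_pos (by omega)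
  have h3 : (x * N.choose (a + 1)) * (y * N.choose (b + 1)) ≤ (y * N.choose b) * (x * N.choose a) :=
    Nat.mul_le_mul h1 h2
  have h4 : N.choose (a + 1) * N.choose (b + 1) ≤ N.choose b * N.choose a := by
    have : (x * y) * (N.choose (a + 1) * N.choose (b + 1)) ≤ (x * y) * (N.choose b * N.choose a) := by
      nlinarith
    exact Nat.le_of_mul_le_mul_left this (by positivity)
  have h5 : (N.choose a * (N - a)) * (N.choose b * (N - b)) ≤
      (N.choose b * N.choose a) * ((a + 1) * (b + 1)) := by
    rw [← e1, ← e2]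
    calc _ = (N.choose (a + 1) * N.choose (b + 1)) * ((a + 1) * (b + 1)) := by ring
      _ ≤ _ := Nat.mul_le_mul_right _ h4
  have h6 : (N.choose b * N.choose a) * ((N - a) * (N - b)) ≤
      (N.choose b * N.choose a) * ((a + 1) * (b + 1)) := by
    calc _ = (N.choose a * (N - a)) * (N.choose b * (N - b)) := by ring
      _ ≤ _ := h5
  have h7 := Nat.le_of_mul_le_mul_left h6 (by positivity)
  have h8 : (b + 1) * (a + 1) < (N - a) * (N - b) := 
    Nat.mul_lt_mul'' (by omega) (by omega)
  linarith [mul_comm (a + 1) (b + 1)]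

lemma arith {n k t m i : ℕ} (hn : (t + 1) * (k - t + 1) < n) (ht : 1 ≤ t) (htk : t < k)
    (him : i + i = m + t) (hmt : t < m) (hik : i ≤ k)
    (h : (m - i) * (n - m).choose (k - i + 1) ≤ (i - 1) * (n - m).choose (k - i)) : False := by
  obtain ⟨s, rfl⟩ : ∃ s, i = t + s := ⟨i - t, by omega⟩
  obtain rfl : m = t + 2 * s := by omega
  obtain ⟨a, rfl⟩ : ∃ a, k = t + s + a := ⟨k - (t + s), by omega⟩
  have hs : 1 ≤ s := by omega
  rw [show t + s + a - t + 1 = s + a + 1 by omega] at hn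
  rw [show t + s + a - (t + s) = a by omega, show t + 2 * s - (t + s) = s by omega] at h
  have hb : t + 2 * s + a ≤ n := by nlinarith
  obtain ⟨c, rfl⟩ : ∃ c, n = t + 2 * s + a + c := ⟨n - (t + 2 * s + a), by omega⟩
  rw [show t + 2 * s + a + c - (t + 2 * s) = a + c by omega] at h
  have e := Nat.choose_succ_right_eq (a + c) a
  rw [show a + c - a = c by omega] at e
  have pos : 0 < (a + c).choose a := Nat.choose_pos (by omega)
  have h2 : (a + c).choose a * (s * c) ≤ (a + c).choose a * ((t + s - 1) * (a + 1)) := by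
    calc _ = s * ((a + c).choose a * c) := by ring
      _ = (s * (a + c).choose (a + 1)) * (a + 1) := by rw [← e]; ring
      _ ≤ ((t + s - 1) * (a + c).choose a) * (a + 1) := Nat.mul_le_mul_right _ h
      _ = _ := by ring
  have h3 := Nat.le_of_mul_le_mul_left h2 pos
  obtain ⟨u, rfl⟩ : ∃ u, t = u + 1 := ⟨t - 1, by omega⟩
  obtain ⟨v, rfl⟩ : ∃ v, s = v + 1 := ⟨s - 1, by omega⟩
  rw [show u + 1 + (v + 1) - 1 = u + v + 1 by omega] at h3
  have h4 := Nat.mul_le_mul_left (v + 1) (Nat.succ_le_of_lt hn)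
  have h5 : 0 ≤ u * v * a := by positivity
  have h6 : 0 ≤ u * v * v := by positivity
  have h7 : 0 ≤ u * v := by positivity
  simp only [Nat.succ_eq_add_one] at h4
  nlinarith

lemma noBd {p : Ω → ℕ} {k t m : ℕ} (ht : 1 ≤ t) (htk : t < k)
    (hn : (t + 1) * (k - t + 1) < Fintype.card Ω) {F V : Finset (Finset Ω)} (hF : Mx k t F)
    (hVk : ∀ A ∈ V, A.card ≤ k) (hTI : TI t V) (hVF : V.filter (fun A => A.card = k) = F)
    (hVm : ∀ V' : Finset (Finset Ω), (∀ A ∈ V', A.card ≤ k) → TI t V' →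
      V'.filter (fun A => A.card = k) = F → V'.card ≤ V.card)
    (hst : Stab p V)
    {I : Finset Ω} {z : Ω} (hlt : ∀ l ∈ I, l ≠ z → p l < p z)
    (hI : ∀ A ∈ V, A ∩ I ∈ V) (hIm : I.card = m) (hm : t < m) : Bd V I z = ∅ := by
  by_contra hne
  obtain ⟨E0, hE0⟩ := nonempty_iff_ne_empty.2 hne
  have hn2 : 2 * k - t + 2 ≤ Fintype.card Ω := by
    obtain ⟨a, rfl⟩ : ∃ a, k = t + 1 + a := ⟨k - t - 1, by omega⟩
    rw [show t + 1 + a - t + 1 = a + 2 by omega] at hn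
    have : 2 * (t + 1 + a) - t + 1 = t + 2 * a + 3 := by omega
    have : t + 2 * a + 3 ≤ (t + 1) * (a + 2) := by nlinarith
    omega
  have sw := fun S R => swap (S := S) (R := R) hF hVk hTI hVF hVm hst hlt hI
  set B := Bd V I z with hB
  have hsz : ∀ D ∈ B, ∀ E ∈ B, D ∪ E = I → (D ∩ E).card = t → D.card + E.card = m + t := by
    intro D _ E _ h1 h2
    have := card_union_add_card_inter D E
    rw [h1, h2, hIm] at this; omega
  have hEm : ∀ E ∈ B, E.card ≤ m ∧ E.card ≤ k ∧ t ≤ E.card := by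
    intro E hE
    have h := mem_Bd.1 hE
    refine ⟨hIm ▸ card_le_card h.2.1, hVk E h.1, ?_⟩
    have := hTI E h.1 E h.1
    rwa [inter_self] at this
  set i := E0.card with hi
  have hEi := hEm E0 hE0
  set j := m + t - i with hj
  set Bi := B.filter (fun E => E.card = i) with hBi
  set Bj := B.filter (fun E => E.card = j) with hBj
  have hE0i : E0 ∈ Bi := mem_filter.2 ⟨hE0, rfl⟩
  by_cases hij : i = j
  · have key : ∀ l ∈ I.erase z,
        (Bi.filter (fun E => l ∉ E)).card * (Fintype.card Ω - m).choose (k - i + 1) ≤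
        (Bi.filter (fun E => l ∈ E)).card * (Fintype.card Ω - m).choose (k - i) := by
      intro l hl
      have := (sw (Bi.filter (fun E => l ∉ E)) (Bi.filter (fun E => l ∈ E))
        ((filter_subset _ _).trans (filter_subset _ _))
        ((filter_subset _ _).trans (filter_subset _ _))
        (fun E h1 h2 => (mem_filter.1 h1).2 (mem_filter.1 h2).2)
        (by
          intro E hE D hD hDR h1 h2
          rw [mem_filter, hBi, mem_filter] at hE
          have h3 := hsz D hD E hE.1.1 h1 h2
          have hlu : l ∈ D ∪ E := by rw [h1]; exact (mem_erase.1 hl).2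
          have hlD : l ∈ D := (mem_union.1 hlu).resolve_right hE.2
          refine hDR (mem_filter.2 ⟨mem_filter.2 ⟨hD, ?_⟩, hlD⟩)
          omega)).1
      have e1 : ∀ q : Ω → Finset Ω → Prop, ∀ [∀ l, DecidablePred (q l)], ∀ g : ℕ → ℕ,
          ∑ E ∈ Bi.filter (q l), g E.card = (Bi.filter (q l)).card * g i := by
        intro q _ g
        rw [← smul_eq_mul, ← sum_const]
        refine sum_congr rfl fun E hE => ?_
        rw [(mem_filter.1 (mem_filter.1 hE).1).2]
      rw [e1 (fun l E => l ∉ E) (fun c => (Fintype.card Ω - I.card).choose (k - c + 1)),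
        e1 (fun l E => l ∈ E) (fun c => (Fintype.card Ω - I.card).choose (k - c)), hIm] at this
      exact this
    have hsum := sum_le_sum key
    rw [← sum_mul, ← sum_mul] at hsum
    have c1 : ∑ l ∈ I.erase z, (Bi.filter (fun E => l ∉ E)).card = Bi.card * (m - i) := by
      simp_rw [card_filter]
      rw [sum_comm, ← smul_eq_mul, ← sum_const]
      refine sum_congr rfl fun E hE => ?_
      rw [← card_filter]
      have hE' := mem_filter.1 hE
      have hEB := mem_Bd.1 hE'.1
      have : (I.erase z).filter (fun l => l ∉ E) = I \ E := by
        ext a; simp only [mem_filter, mem_erase, mem_sdiff]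
        have := hEB.2.2.1
        grind
      rw [this, card_sdiff_of_subset hEB.2.1, hE'.2, hIm]
    have c2 : ∑ l ∈ I.erase z, (Bi.filter (fun E => l ∈ E)).card = Bi.card * (i - 1) := by
      simp_rw [card_filter]
      rw [sum_comm, ← smul_eq_mul, ← sum_const]
      refine sum_congr rfl fun E hE => ?_
      rw [← card_filter]
      have hE' := mem_filter.1 hE
      have hEB := mem_Bd.1 hE'.1
      have : (I.erase z).filter (fun l => l ∈ E) = E.erase z := by
        ext a; simp only [mem_filter, mem_erase]
        have := @hEB.2.1 a
        grind
      rw [this, card_erase_of_mem hEB.2.2.1, hE'.2]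
    rw [c1, c2, mul_assoc, mul_assoc] at hsum
    have := Nat.le_of_mul_le_mul_left hsum (card_pos.2 ⟨E0, hE0i⟩)
    exact arith hn ht htk (by omega) hm hEi.2.1 this
  · have hc : ∀ a b : ℕ, a + b = m + t → a ≠ b →
        ∀ E ∈ B.filter (fun E => E.card = a), ∀ D ∈ B, D ∉ B.filter (fun E => E.card = b) →
          D ∪ E = I → (D ∩ E).card = t → False := by
      intro a b hab _ E hE D hD hDR h1 h2
      have h3 := hsz D hD E (mem_filter.1 hE).1 h1 h2
      have h4 := (mem_filter.1 hE).2
      exact hDR (mem_filter.2 ⟨hD, by omega⟩)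
    have hdd : ∀ a b : ℕ, a ≠ b → ∀ E ∈ B.filter (fun E => E.card = a),
        E ∉ B.filter (fun E => E.card = b) := by
      intro a b hab E h1 h2
      exact hab ((mem_filter.1 h1).2.symm.trans (mem_filter.1 h2).2)
    have s1 := sw Bi Bj (filter_subset _ _) (filter_subset _ _) (hdd i j hij)
      (hc i j (by omega) hij)
    have s2 := sw Bj Bi (filter_subset _ _) (filter_subset _ _) (hdd j i (Ne.symm hij))
      (hc j i (by omega) (Ne.symm hij))
    have hBjne : Bj.Nonempty := by
      rw [nonempty_iff_ne_empty]
      intro h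
      have := s1.2 h
      rw [this] at hE0i; simp at hE0i
    obtain ⟨E1, hE1⟩ := hBjne
    have hE1' := mem_filter.1 hE1
    have hEj := hEm E1 hE1'.1
    rw [hE1'.2] at hEj
    have e1 : ∀ a : ℕ, ∀ g : ℕ → ℕ,
        ∑ E ∈ B.filter (fun E => E.card = a), g E.card
          = (B.filter (fun E => E.card = a)).card * g a := by
      intro a g
      rw [← smul_eq_mul, ← sum_const]
      refine sum_congr rfl fun E hE => ?_
      rw [(mem_filter.1 hE).2]
    have t1 := s1.1
    have t2 := s2.1
    rw [hBi, hBj, e1 i (fun c => (Fintype.card Ω - I.card).choose (k - c + 1)),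
        e1 j (fun c => (Fintype.card Ω - I.card).choose (k - c))] at t1
    rw [hBi, hBj, e1 j (fun c => (Fintype.card Ω - I.card).choose (k - c + 1)),
        e1 i (fun c => (Fintype.card Ω - I.card).choose (k - c))] at t2
    exact choose_ineq (by omega) (card_pos.2 ⟨E0, hE0i⟩) (card_pos.2 ⟨E1, hE1⟩) t1 t2

lemma stable_star {k t : ℕ} (ht : 1 ≤ t) (htk : t < k)
    (hn : (t + 1) * (k - t + 1) < Fintype.card Ω) (e : Ω ≃ Fin (Fintype.card Ω))
    {F : Finset (Finset Ω)} (hF : Mx k t F)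
    (hFne : F.Nonempty) (hst : Stab (fun x => (e x).val) F) :
    ∃ T : Finset Ω, T.card = t ∧ F = stF Ω k T := by
  classical
  set p : Ω → ℕ := fun x => (e x).val with hp
  set 𝒞 := (univ : Finset (Finset (Finset Ω))).filter (fun V => (∀ A ∈ V, A.card ≤ k) ∧ TI t V ∧
    V.filter (fun A => A.card = k) = F) with h𝒞
  have hm𝒞 : ∀ V, V ∈ 𝒞 ↔ ((∀ A ∈ V, A.card ≤ k) ∧ TI t V ∧
    V.filter (fun A => A.card = k) = F) := fun V => by simp [h𝒞]
  have h𝒞ne : F ∈ 𝒞 := (hm𝒞 F).2 ⟨fun A hA => (hF.1 A hA).le, hF.2.1,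
    filter_true_of_mem hF.1⟩
  obtain ⟨V0, hV0, hV0m⟩ := exists_max_image 𝒞 card ⟨F, h𝒞ne⟩
  obtain ⟨V, hV, hVmin⟩ := exists_min_image (𝒞.filter (fun V => V.card = V0.card)) (wt p)
    ⟨V0, mem_filter.2 ⟨hV0, rfl⟩⟩
  rw [mem_filter] at hV
  obtain ⟨hVk, hTI, hVF⟩ := (hm𝒞 V).1 hV.1
  have hVst : Stab p V := by
    intro A hA x z hx hz hxz
    by_contra hmv
    have hlt := wt_shf_lt hxz hA hx hz hmv
    refine absurd (hVmin (shf x z V) ?_) (not_le.2 hlt)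
    rw [mem_filter, shf_card, hm𝒞]
    refine ⟨⟨?_, shf_TI hTI, ?_⟩, hV.2⟩
    · intro C hC
      obtain ⟨D, hD, rfl⟩ := mem_image.1 hC
      rw [phi_card]; exact hVk D hD
    · have hFV : ∀ D ∈ V, D.card = k → phi x z V D = D := by
        intro D hD hDk
        unfold phi
        rw [if_neg]
        rintro ⟨h1, h2, h3⟩
        have hDF : D ∈ F := by rw [← hVF]; exact mem_filter.2 ⟨hD, hDk⟩
        have := hst D hDF x z h1 h2 hxz
        rw [← hVF] at this
        exact h3 (mem_filter.1 this).1
      rw [← hVF]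
      ext C
      simp only [mem_filter, shf, mem_image]
      constructor
      · rintro ⟨⟨D, hD, rfl⟩, hc⟩
        rw [phi_card] at hc
        rw [hFV D hD hc]; exact ⟨hD, hc⟩
      · rintro ⟨hC, hc⟩
        exact ⟨⟨C, hC, hFV C hC hc⟩, hc⟩
  have hVm : ∀ V' : Finset (Finset Ω), (∀ A ∈ V', A.card ≤ k) → TI t V' →
      V'.filter (fun A => A.card = k) = F → V'.card ≤ V.card := by
    intro V' h1 h2 h3
    rw [hV.2]; exact hV0m V' ((hm𝒞 V').2 ⟨h1, h2, h3⟩)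
  let I : ℕ → Finset Ω := fun m => univ.filter (fun x => p x < m)
  have hIc : ∀ m ≤ Fintype.card Ω, (I m).card = m := by
    intro m hm
    have : (I m).card = ((range m).card) := by
      refine card_bij (fun x _ => p x) ?_ ?_ ?_
      · intro x hx; simpa [I] using hx
      · intro x _ y _ h; exact e.injective (Fin.ext h)
      · intro b hb
        rw [mem_range] at hb
        refine ⟨e.symm ⟨b, by omega⟩, ?_, ?_⟩ <;> simp [I, p, hb]
    rw [this, card_range]
  have hex : ∃ m, ∀ A ∈ V, A ∩ I m ∈ V := by
    refine ⟨Fintype.card Ω, fun A hA => ?_⟩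
    have : I (Fintype.card Ω) = univ := by
      ext x; simp [I, p]
    rw [this, inter_univ]; exact hA
  set m := Nat.find hex with hm
  have hmI : ∀ A ∈ V, A ∩ I m ∈ V := Nat.find_spec hex
  have hmn : m ≤ Fintype.card Ω := by
    refine Nat.find_min' hex fun A hA => ?_
    have : I (Fintype.card Ω) = univ := by
      ext x; simp [I, p]
    rw [this, inter_univ]; exact hA
  have hFV : ∀ A ∈ F, A ∈ V := fun A hA => by
    rw [← hVF] at hA; exact (mem_filter.1 hA).1
  have hVt : ∀ A ∈ V, t ≤ A.card := fun A hA => by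
    have := hTI A hA A hA
    rwa [inter_self] at this
  obtain ⟨A0, hA0⟩ := hFne
  have htm : t ≤ m := by
    have h1 := hVt _ (hmI A0 (hFV A0 hA0))
    have h2 := card_le_card (inter_subset_right : A0 ∩ I m ⊆ I m)
    rw [hIc m hmn] at h2
    omega
  have hmt : m = t := by
    by_contra hne
    have hmt : t < m := by omega
    have hmin := Nat.find_min hex (m := m - 1) (by omega)
    push Not at hmin
    obtain ⟨A, hA, hAn⟩ := hmin
    let z : Ω := e.symm ⟨m - 1, by omega⟩
    have hpz : p z = m - 1 := by simp [p, z]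
    have hpi : ∀ x, p x = p z → x = z := fun x h => e.injective (Fin.ext h)
    have hIer : (I m).erase z = I (m - 1) := by
      ext x
      simp only [I, mem_erase, mem_filter, mem_univ, true_and]
      constructor
      · rintro ⟨h1, h2⟩
        have : p x ≠ p z := fun h => h1 (hpi x h)
        omega
      · intro h
        exact ⟨fun h1 => by subst h1; omega, by omega⟩
    have hlt : ∀ l ∈ I m, l ≠ z → p l < p z := by
      intro l hl hlz
      have : l ∈ I (m - 1) := by rw [← hIer]; exact mem_erase.2 ⟨hlz, hl⟩
      simp only [I, mem_filter, mem_univ, true_and] at this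
      omega
    have hB := noBd ht htk hn hF hVk hTI hVF hVm hVst hlt hmI (hIc m hmn) hmt
    have he : (A ∩ I m).erase z = A ∩ I (m - 1) := by
      rw [← hIer]; ext a; simp only [mem_inter, mem_erase]; tauto
    have : A ∩ I m ∈ Bd V (I m) z := by
      refine mem_Bd.2 ⟨hmI A hA, inter_subset_right, ?_, by rw [he]; exact hAn⟩
      by_contra hz
      rw [erase_eq_of_notMem hz] at he
      exact hAn (he ▸ hmI A hA)
    rw [hB] at this
    simp at this
  have hIt : (I m).card = t := by rw [hIc m hmn, hmt]
  refine ⟨I m, hIt, eq_of_subset_of_card_le ?_ (hF.2.2 _ (fun A hA => (mem_stF.1 hA).1) (stF_TI hIt))⟩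
  intro A hA
  refine mem_stF.2 ⟨hF.1 A hA, ?_⟩
  have : A ∩ I m = I m := eq_of_subset_of_card_le inter_subset_right
    (by rw [hIt]; exact hVt _ (hmI A (hFV A hA)))
  exact inter_eq_right.1 this

lemma max_star {k t : ℕ} (ht : 1 ≤ t) (htk : t < k)
    (hn : (t + 1) * (k - t + 1) < Fintype.card Ω) (e : Ω ≃ Fin (Fintype.card Ω)) :
    ∀ w : ℕ, ∀ F : Finset (Finset Ω), Mx k t F → F.Nonempty → wt (fun x => (e x).val) F = w →
    ∃ T : Finset Ω, T.card = t ∧ F = stF Ω k T := by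
  intro w
  induction w using Nat.strong_induction_on with
  | _ w ih =>
    intro F hF hne hw
    by_cases hst : Stab (fun x => (e x).val) F
    · exact stable_star ht htk hn e hF hne hst
    unfold Stab at hst
    push Not at hst
    obtain ⟨A, hA, x, z, hx, hz, hxz, hmv⟩ := hst
    have hlt := wt_shf_lt (p := fun x => (e x).val) hxz hA hx hz hmv
    have hn2 : 2 * k - t + 2 ≤ Fintype.card Ω := by
      obtain ⟨a, rfl⟩ : ∃ a, k = t + 1 + a := ⟨k - t - 1, by omega⟩
      rw [show t + 1 + a - t + 1 = a + 2 by omega] at hn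
      have : 2 * (t + 1 + a) - t + 1 = t + 2 * a + 3 := by omega
      have : t + 2 * a + 3 ≤ (t + 1) * (a + 2) := by nlinarith
      omega
    obtain ⟨T, hT, hTs⟩ := ih _ (hw ▸ hlt) (shf x z F)
      ⟨by
        intro C hC
        obtain ⟨D, hD, rfl⟩ := mem_image.1 hC
        rw [phi_card]; exact hF.1 D hD,
       shf_TI hF.2.1, by rw [shf_card]; exact hF.2.2⟩
      (by rw [← card_pos, shf_card, card_pos]; exact hne) rfl
    exact unshift htk hn2 hF.1 hF.2.1 (fun h => by subst h; exact hx hz) hT hTs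

end

end


/-- **Erdős–Ko–Rado theorem for `t`-intersecting families (Frankl–Wilson bound).**
Let `Ω` be a finite set with `|Ω| = n` and `1 ≤ t < k`. If `n > (t+1)(k-t+1)` and `𝓕` is a
`t`-intersecting family of `k`-element subsets of `Ω`, then `|𝓕| ≤ C(n-t, k-t)`, with
equality iff `𝓕` consists of all `k`-subsets containing a fixed `t`-element subset. -/
theorem ekr_t_intersecting {Ω : Type*} [Fintype Ω] [DecidableEq Ω] (n k t : ℕ)
    (hn : Fintype.card Ω = n) (ht : 1 ≤ t) (htk : t < k)
    (hbig : (t + 1) * (k - t + 1) < n)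
    (𝓕 : Finset (Finset Ω))
    (hsize : ∀ A ∈ 𝓕, A.card = k)
    (hint : ∀ A ∈ 𝓕, ∀ B ∈ 𝓕, t ≤ (A ∩ B).card) :
    𝓕.card ≤ (n - t).choose (k - t) ∧
      (𝓕.card = (n - t).choose (k - t) ↔
        ∃ T : Finset Ω, T.card = t ∧
          𝓕 = (Finset.powersetCard k Finset.univ).filter (fun A => T ⊆ A)) := by


  classical
  subst hn
  have hmain : ∀ F : Finset (Finset Ω), Mx k t F → F.Nonempty →
      ∃ T : Finset Ω, T.card = t ∧ F = stF Ω k T := fun F h1 h2 =>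
    max_star ht htk hbig (Fintype.equivFin Ω) _ F h1 h2 rfl
  obtain ⟨F, hF, hFm⟩ := Finset.exists_max_image
    ((Finset.univ : Finset (Finset (Finset Ω))).filter
      (fun F => (∀ A ∈ F, A.card = k) ∧ TI t F)) Finset.card
    ⟨𝓕, Finset.mem_filter.2 ⟨Finset.mem_univ _, hsize, hint⟩⟩
  have hFM : ∀ G : Finset (Finset Ω), (∀ A ∈ G, A.card = k) → TI t G → G.card ≤ F.card :=
    fun G h1 h2 => hFm G (Finset.mem_filter.2 ⟨Finset.mem_univ _, h1, h2⟩)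
  obtain ⟨-, hFk, hFT⟩ := Finset.mem_filter.1 hF
  have hkn : k ≤ Fintype.card Ω := by
    obtain ⟨a, rfl⟩ : ∃ a, k = t + a := ⟨k - t, by omega⟩
    rw [show t + a - t + 1 = a + 1 by omega] at hbig
    nlinarith
  have hpos : 0 < (Fintype.card Ω - t).choose (k - t) := Nat.choose_pos (by omega)
  obtain ⟨T0, -, hT0⟩ := Finset.exists_subset_card_eq
    (s := (Finset.univ : Finset Ω)) (n := t) (by rw [Finset.card_univ]; omega)
  have hle := hFM (stF Ω k T0) (fun A hA => (mem_stF.1 hA).1) (stF_TI hT0)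
  rw [stF_card hT0 htk.le] at hle
  have hFc : F.card = (Fintype.card Ω - t).choose (k - t) := by
    obtain ⟨T, hT, hTs⟩ := hmain F ⟨hFk, hFT, hFM⟩ (Finset.card_pos.1 (by omega))
    rw [hTs, stF_card hT htk.le]
  refine ⟨hFc ▸ hFM 𝓕 hsize hint, ?_, ?_⟩
  · intro hc
    exact hmain 𝓕 ⟨hsize, hint, fun G h1 h2 => by rw [hc, ← hFc]; exact hFM G h1 h2⟩
      (Finset.card_pos.1 (by omega))
  · rintro ⟨T, hT, hTs⟩
    rw [hTs]
    exact stF_card hT htk.le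
end

section
/- Let Ω be a finite set of cardinality n, let k ≥ 3 and n ≥ 2k+1, and let 𝓕 be an intersecting family of k-element subsets of Ω such that the members of 𝓕 have no common element. Then |𝓕| ≤ C(n−1, k−1) − C(n−k−1, k−1) + 1. Equality holds if and only if either (i) there exist a k-subset F of Ω and an element x ∉ F such that 𝓕 = {F} ∪ {G : G is a k-subset of Ω, x ∈ G, G ∩ F ≠ ∅}, or (ii) k = 3 and 𝓕 is the set of all 3-element subsets of Ω meeting a fixed 3-element subset F of Ω in at least 2 elements. -/
namespace HMAux

def mv (i j : ℕ) (F : Finset (Finset ℕ)) (S : Finset ℕ) : Finset ℕ :=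
  if j ∈ S ∧ i ∉ S ∧ insert i (S.erase j) ∉ F then insert i (S.erase j) else S

def sh (i j : ℕ) (F : Finset (Finset ℕ)) : Finset (Finset ℕ) := F.image (mv i j F)

def Stable (n : ℕ) (F : Finset (Finset ℕ)) : Prop :=
  ∀ i j, i < j → j < n → ∀ S ∈ F, j ∈ S → i ∉ S → insert i (S.erase j) ∈ F

def wt (F : Finset (Finset ℕ)) : ℕ := ∑ S ∈ F, ∑ x ∈ S, x

lemma mv_injOn (i j : ℕ) (F : Finset (Finset ℕ)) : Set.InjOn (mv i j F) F := by
  intro S hS T hT h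
  have hS' : S ∈ F := hS
  have hT' : T ∈ F := hT
  unfold mv at h
  split_ifs at h with h1 h2 h2
  · ext e
    have := Finset.ext_iff.1 h e
    simp only [Finset.mem_insert, Finset.mem_erase] at this
    grind
  · exact absurd (h ▸ hT') h1.2.2
  · exact absurd (h ▸ hS') h2.2.2
  · exact h

lemma card_sh (i j : ℕ) (F : Finset (Finset ℕ)) : (sh i j F).card = F.card :=
  Finset.card_image_of_injOn (mv_injOn i j F)

lemma sum_move {i j : ℕ} (hij : i < j) {S : Finset ℕ} (hj : j ∈ S) (hi : i ∉ S) :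
    ∑ x ∈ insert i (S.erase j), x < ∑ x ∈ S, x := by
  rw [Finset.sum_insert (by simp [hi]), ← Finset.add_sum_erase S _ hj]
  omega

lemma card_move {i j : ℕ} {S : Finset ℕ} (hj : j ∈ S) (hi : i ∉ S) :
    (insert i (S.erase j)).card = S.card := by
  rw [Finset.card_insert_of_notMem (by simp [hi]), Finset.card_erase_of_mem hj]
  have := Finset.card_pos.2 ⟨j, hj⟩
  omega

lemma mv_le {i j : ℕ} (hij : i < j) (F : Finset (Finset ℕ)) (S : Finset ℕ) :
    ∑ x ∈ mv i j F S, x ≤ ∑ x ∈ S, x := by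
  unfold mv
  split_ifs with h
  · exact (sum_move hij h.1 h.2.1).le
  · exact le_rfl

lemma wt_sh_le {i j : ℕ} (hij : i < j) (F : Finset (Finset ℕ)) : wt (sh i j F) ≤ wt F := by
  unfold wt sh
  rw [Finset.sum_image (mv_injOn i j F)]
  exact Finset.sum_le_sum fun S _ => mv_le hij F S

lemma wt_sh_lt {i j : ℕ} (hij : i < j) (F : Finset (Finset ℕ)) {S : Finset ℕ} (hS : S ∈ F)
    (hj : j ∈ S) (hi : i ∉ S) (h : insert i (S.erase j) ∉ F) : wt (sh i j F) < wt F := by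
  unfold wt sh
  rw [Finset.sum_image (mv_injOn i j F)]
  refine Finset.sum_lt_sum (fun S _ => mv_le hij F S) ⟨S, hS, ?_⟩
  unfold mv
  rw [if_pos ⟨hj, hi, h⟩]
  exact sum_move hij hj hi

lemma sh_sub {i j n k : ℕ} (hij : i < j) {F : Finset (Finset ℕ)}
    (hF : F ⊆ Finset.powersetCard k (Finset.range n)) :
    sh i j F ⊆ Finset.powersetCard k (Finset.range n) := by
  intro T hT
  obtain ⟨S, hS, rfl⟩ := Finset.mem_image.1 hT
  have h1 := Finset.mem_powersetCard.1 (hF hS)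
  unfold mv
  split_ifs with h
  · rw [Finset.mem_powersetCard, card_move h.1 h.2.1]
    refine ⟨?_, h1.2⟩
    intro e he
    have hj := Finset.mem_range.1 (h1.1 h.1)
    rcases Finset.mem_insert.1 he with rfl | he
    · exact Finset.mem_range.2 (by omega)
    · exact h1.1 (Finset.mem_of_mem_erase he)
  · exact hF hS

def Cross {α : Type*} (A B : Finset (Finset α)) : Prop := ∀ a ∈ A, ∀ b ∈ B, ∃ e, e ∈ a ∧ e ∈ b

lemma Cross.symm {α : Type*} {A B : Finset (Finset α)} (h : Cross A B) : Cross B A :=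
  fun b hb a ha => by
    obtain ⟨e, h1, h2⟩ := h a ha b hb
    exact ⟨e, h2, h1⟩

lemma cross_aux {i j : ℕ} {A B : Finset (Finset ℕ)} (h : Cross A B) {a b : Finset ℕ}
    (ha : a ∈ A) (hb : b ∈ B) (hj : j ∈ a) (hi : i ∉ a)
    (hb2 : ¬ (j ∈ b ∧ i ∉ b ∧ insert i (b.erase j) ∉ B)) :
    ∃ e, e ∈ insert i (a.erase j) ∧ e ∈ b := by
  by_cases hib : i ∈ b
  · exact ⟨i, by simp, hib⟩
  by_cases hjb : j ∈ b
  · have : insert i (b.erase j) ∈ B := by tauto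
    obtain ⟨e, h1, h2⟩ := h a ha _ this
    refine ⟨e, ?_, ?_⟩ <;> grind
  · obtain ⟨e, h1, h2⟩ := h a ha b hb
    refine ⟨e, ?_, h2⟩
    grind

lemma cross_sh {i j : ℕ} {A B : Finset (Finset ℕ)} (h : Cross A B) :
    Cross (sh i j A) (sh i j B) := by
  intro a' ha' b' hb'
  obtain ⟨a, ha, rfl⟩ := Finset.mem_image.1 ha'
  obtain ⟨b, hb, rfl⟩ := Finset.mem_image.1 hb'
  unfold mv
  split_ifs with h1 h2 h2
  · exact ⟨i, by simp, by simp⟩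
  · exact cross_aux h ha hb h1.1 h1.2.1 h2
  · obtain ⟨e, h3, h4⟩ := cross_aux h.symm hb ha h2.1 h2.2.1 h1
    exact ⟨e, h4, h3⟩
  · exact h a ha b hb

/-- iterate shifts -/
lemma exists_stable (n : ℕ) (R : Finset (Finset ℕ) → Finset (Finset ℕ) → Prop)
    (hR : ∀ i j A B, i < j → j < n → R A B → R (sh i j A) (sh i j B)) :
    ∀ N A B, wt A + wt B ≤ N → R A B → ∃ A' B', R A' B' ∧ Stable n A' ∧ Stable n B' := by
  intro N
  induction N using Nat.strong_induction_on with
  | _ N ih =>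
    intro A B hN h
    by_cases hA : Stable n A
    · by_cases hB : Stable n B
      · exact ⟨A, B, h, hA, hB⟩
      · unfold Stable at hB
        push Not at hB
        obtain ⟨i, j, hij, hj, S, hS, h1, h2, h3⟩ := hB
        have l1 := wt_sh_lt hij B hS h1 h2 h3
        have l2 := wt_sh_le hij A
        exact ih (wt (sh i j A) + wt (sh i j B)) (by omega) _ _ le_rfl (hR i j A B hij hj h)
    · unfold Stable at hA
      push Not at hA
      obtain ⟨i, j, hij, hj, S, hS, h1, h2, h3⟩ := hA
      have l1 := wt_sh_lt hij A hS h1 h2 h3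
      have l2 := wt_sh_le hij B
      exact ih (wt (sh i j A) + wt (sh i j B)) (by omega) _ _ le_rfl (hR i j A B hij hj h)

/-- minimal element in a stable family -/
lemma stable_min {n k t : ℕ} {F : Finset (Finset ℕ)} (hst : Stable n F)
    (hF : F ⊆ Finset.powersetCard k (Finset.range n)) :
    ∀ N, ∀ S ∈ F, ∑ x ∈ S, x ≤ N → (∀ x ∈ S, t ≤ x) → Finset.Ico t (t + k) ∈ F := by
  intro N
  induction N using Nat.strong_induction_on with
  | _ N ih =>
    intro S hS hN ht
    have h1 := Finset.mem_powersetCard.1 (hF hS)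
    by_cases hsub : S ⊆ Finset.Ico t (t + k)
    · rwa [← Finset.eq_of_subset_of_card_le hsub (by simp [h1.2])]
    · obtain ⟨j, hjS, hj⟩ := Finset.not_subset.1 hsub
      have hnot : ¬ Finset.Ico t (t + k) ⊆ S := by
        intro hc
        have := Finset.eq_of_subset_of_card_le hc (by simp [h1.2])
        exact hsub this.symm.subset
      obtain ⟨i, hi, hiS⟩ := Finset.not_subset.1 hnot
      have := ht j hjS
      rw [Finset.mem_Ico] at hi hj
      have hij : i < j := by omega
      have hm := hst i j hij (Finset.mem_range.1 (h1.1 hjS)) S hS hjS hiS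
      refine ih (∑ x ∈ insert i (S.erase j), x) (lt_of_lt_of_le (sum_move hij hjS hiS) hN) _ hm
        le_rfl ?_
      intro x hx
      rcases Finset.mem_insert.1 hx with rfl | hx
      · exact hi.1
      · exact ht x (Finset.mem_of_mem_erase hx)

/-- counting -/
lemma card_meet {α : Type*} [DecidableEq α] (U X : Finset α) (r : ℕ) (hX : X ⊆ U) :
    ((Finset.powersetCard r U).filter (fun S => ∃ e, e ∈ S ∧ e ∈ X)).card
      + (U.card - X.card).choose r = U.card.choose r := by
  rw [← Finset.card_sdiff_of_subset hX, ← Finset.card_powersetCard r (U \ X),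
    ← Finset.card_powersetCard r U,
    ← Finset.card_filter_add_card_filter_not (s := Finset.powersetCard r U)
      (fun S => ∃ e, e ∈ S ∧ e ∈ X)]
  congr 2
  ext S
  simp only [Finset.mem_filter, Finset.mem_powersetCard, Finset.subset_iff, Finset.mem_sdiff]
  grind

lemma card_le_meet {α : Type*} [DecidableEq α] (U X : Finset α) (r : ℕ) (hX : X ⊆ U)
    (C : Finset (Finset α)) (hC : C ⊆ Finset.powersetCard r U)
    (h1 : ∀ S ∈ C, ∃ e, e ∈ S ∧ e ∈ X) :
    C.card + (U.card - X.card).choose r ≤ U.card.choose r := by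
  rw [← card_meet U X r hX]
  gcongr
  intro S hS
  exact Finset.mem_filter.2 ⟨hC hS, h1 S hS⟩

lemma card_lt_meet {α : Type*} [DecidableEq α] (U X Y : Finset α) (r : ℕ) (hX : X ⊆ U)
    (hXY : ¬ X ⊆ Y) (hU : Y.card + (r + 1) ≤ U.card)
    (C : Finset (Finset α)) (hC : C ⊆ Finset.powersetCard (r + 1) U)
    (h1 : ∀ S ∈ C, ∃ e, e ∈ S ∧ e ∈ X) (h2 : ∀ S ∈ C, ∃ e, e ∈ S ∧ e ∈ Y) :
    C.card + (U.card - X.card).choose (r + 1) < U.card.choose (r + 1) := by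
  rw [← card_meet U X (r + 1) hX]
  apply Nat.add_lt_add_right
  obtain ⟨p, hp, hpY⟩ := Finset.not_subset.1 hXY
  have hc : r ≤ (U \ insert p Y).card := by
    have := Finset.le_card_sdiff (insert p Y) U
    have := Finset.card_insert_le p Y
    omega
  obtain ⟨T, hT, hTc⟩ := Finset.exists_subset_card_eq hc
  have hT2 : ∀ e ∈ T, e ∈ U ∧ e ≠ p ∧ e ∉ Y := by
    intro e he
    have := hT he
    simp only [Finset.mem_sdiff, Finset.mem_insert] at this
    tauto
  apply Finset.card_lt_card
  rw [Finset.ssubset_iff_of_subset]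
  · refine ⟨insert p T, ?_, ?_⟩
    · rw [Finset.mem_filter, Finset.mem_powersetCard]
      refine ⟨⟨?_, ?_⟩, p, by simp, hp⟩
      · intro e he
        rcases Finset.mem_insert.1 he with rfl | he
        · exact hX hp
        · exact (hT2 e he).1
      · rw [Finset.card_insert_of_notMem, hTc]
        intro h
        exact (hT2 p h).2.1 rfl
    · intro h
      obtain ⟨e, he, heY⟩ := h2 _ h
      rcases Finset.mem_insert.1 he with rfl | he
      · exact hpY heY
      · exact (hT2 e he).2.2 heY
  · intro S hS
    exact Finset.mem_filter.2 ⟨hC hS, h1 S hS⟩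

section links
variable {α : Type*} [DecidableEq α]

def lk (x : α) (F : Finset (Finset α)) : Finset (Finset α) :=
  (F.filter (fun S => x ∈ S)).image (fun S => S.erase x)

def dl (x : α) (F : Finset (Finset α)) : Finset (Finset α) := F.filter (fun S => x ∉ S)

lemma mem_lk {x : α} {F : Finset (Finset α)} {T : Finset α} :
    T ∈ lk x F ↔ x ∉ T ∧ insert x T ∈ F := by
  unfold lk
  simp only [Finset.mem_image, Finset.mem_filter]
  constructor
  · rintro ⟨S, ⟨hS, hx⟩, rfl⟩
    exact ⟨by simp, by rwa [Finset.insert_erase hx]⟩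
  · rintro ⟨hx, hT⟩
    exact ⟨insert x T, ⟨hT, by simp⟩, Finset.erase_insert hx⟩

lemma mem_dl {x : α} {F : Finset (Finset α)} {T : Finset α} :
    T ∈ dl x F ↔ T ∈ F ∧ x ∉ T := by
  unfold dl
  simp

lemma card_lk_dl (x : α) (F : Finset (Finset α)) : F.card = (lk x F).card + (dl x F).card := by
  unfold lk dl
  rw [Finset.card_image_of_injOn, Finset.card_filter_add_card_filter_not]
  intro S hS T hT h
  simp only [Finset.coe_filter, Set.mem_ofPred_eq] at hS hT
  have h' : S.erase x = T.erase x := h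
  rw [← Finset.insert_erase hS.2, h', Finset.insert_erase hT.2]

lemma lk_sub {x : α} {F : Finset (Finset α)} {r : ℕ} {V : Finset α}
    (hF : F ⊆ Finset.powersetCard (r + 1) V) : lk x F ⊆ Finset.powersetCard r (V.erase x) := by
  intro T hT
  obtain ⟨h1, h2⟩ := mem_lk.1 hT
  have h3 := Finset.mem_powersetCard.1 (hF h2)
  rw [Finset.card_insert_of_notMem h1] at h3
  rw [Finset.mem_powersetCard]
  refine ⟨?_, by omega⟩
  intro e he
  refine Finset.mem_erase.2 ⟨?_, h3.1 (Finset.mem_insert_of_mem he)⟩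
  rintro rfl
  exact h1 he

lemma dl_sub {x : α} {F : Finset (Finset α)} {r : ℕ} {V : Finset α}
    (hF : F ⊆ Finset.powersetCard r V) : dl x F ⊆ Finset.powersetCard r (V.erase x) := by
  intro T hT
  obtain ⟨h1, h2⟩ := mem_dl.1 hT
  have h3 := Finset.mem_powersetCard.1 (hF h1)
  rw [Finset.mem_powersetCard]
  refine ⟨?_, h3.2⟩
  intro e he
  refine Finset.mem_erase.2 ⟨?_, h3.1 he⟩
  rintro rfl
  exact h2 he

/-- complementary pairs bound -/
lemma card_compl {l : ℕ} {V : Finset α} (hV : V.card = 2 * l) {A B : Finset (Finset α)}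
    (hA : A ⊆ Finset.powersetCard l V) (hB : B ⊆ Finset.powersetCard l V) (h : Cross A B) :
    A.card + B.card ≤ (2 * l).choose l := by
  have hinj : Set.InjOn (fun S => V \ S) (B : Set (Finset α)) := by
    intro S hS T hT hST
    have hS' := (Finset.mem_powersetCard.1 (hB hS)).1
    have hT' := (Finset.mem_powersetCard.1 (hB hT)).1
    have : V \ S = V \ T := hST
    rw [← Finset.sdiff_sdiff_eq_self hS', this, Finset.sdiff_sdiff_eq_self hT']
  rw [← Finset.card_image_of_injOn hinj, ← Finset.card_union_of_disjoint, ← hV,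
    ← Finset.card_powersetCard]
  · apply Finset.card_le_card
    apply Finset.union_subset hA
    intro T hT
    obtain ⟨S, hS, rfl⟩ := Finset.mem_image.1 hT
    have hS' := Finset.mem_powersetCard.1 (hB hS)
    rw [Finset.mem_powersetCard, Finset.card_sdiff_of_subset hS'.1]
    exact ⟨Finset.sdiff_subset, by omega⟩
  · rw [Finset.disjoint_left]
    intro S hS hT
    obtain ⟨T, hT', rfl⟩ := Finset.mem_image.1 hT
    obtain ⟨e, h1, h2⟩ := h _ hS _ hT'
    simp_all
end links

lemma range_erase (M : ℕ) : (Finset.range (M + 1)).erase M = Finset.range M := by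
  ext e
  simp only [Finset.mem_erase, Finset.mem_range]
  omega

lemma stable_lk {M : ℕ} {F : Finset (Finset ℕ)} (h : Stable (M + 1) F) : Stable M (lk M F) := by
  intro i j hij hj S hS hjS hiS
  obtain ⟨h1, h2⟩ := mem_lk.1 hS
  rw [mem_lk]
  constructor
  · grind
  · have := h i j hij (by omega) _ h2 (by simp [hjS]) (by simp [hiS]; omega)
    convert this using 1
    ext e
    grind

lemma stable_dl {M : ℕ} {F : Finset (Finset ℕ)} (h : Stable (M + 1) F) : Stable M (dl M F) := by
  intro i j hij hj S hS hjS hiS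
  obtain ⟨h1, h2⟩ := mem_dl.1 hS
  rw [mem_dl]
  exact ⟨h i j hij (by omega) _ h1 hjS hiS, by grind⟩

lemma cross_lk {M l : ℕ} {A B : Finset (Finset ℕ)} (hst : Stable (M + 1) A)
    (hA : A ⊆ Finset.powersetCard (l + 1) (Finset.range (M + 1)))
    (hB : B ⊆ Finset.powersetCard (l + 1) (Finset.range (M + 1)))
    (h : Cross A B) (hM : 2 * l + 1 ≤ M) : Cross (lk M A) (lk M B) := by
  intro a ha b hb
  have ha' := Finset.mem_powersetCard.1 (lk_sub hA ha)
  have hb' := Finset.mem_powersetCard.1 (lk_sub hB hb)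
  rw [range_erase] at ha' hb'
  obtain ⟨h1, h2⟩ := mem_lk.1 ha
  obtain ⟨h3, h4⟩ := mem_lk.1 hb
  by_contra hc
  push Not at hc
  have : ∃ i ∈ Finset.range M, i ∉ a ∪ b := by
    apply Finset.exists_mem_notMem_of_card_lt_card
    have := Finset.card_union_le a b
    rw [Finset.card_range]
    omega
  obtain ⟨i, hi, hiab⟩ := this
  rw [Finset.mem_range] at hi
  simp only [Finset.mem_union, not_or] at hiab
  have := hst i M hi (by omega) _ h2 (by simp) (by simp [hiab.1]; omega)
  obtain ⟨e, he1, he2⟩ := h _ this _ h4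
  grind

lemma dl_nonempty {M l : ℕ} {A : Finset (Finset ℕ)} (hst : Stable (M + 1) A)
    (hA : A ⊆ Finset.powersetCard l (Finset.range (M + 1))) (hl : l ≤ M) (hne : A.Nonempty) :
    Finset.range l ∈ dl M A := by
  obtain ⟨S, hS⟩ := hne
  have := stable_min (t := 0) hst hA _ S hS le_rfl (by simp)
  rw [mem_dl, Finset.range_eq_Ico]
  refine ⟨by simpa using this, by simp; omega⟩

lemma two_le_choose {N r : ℕ} (hr : 1 ≤ r) (h : r + 1 ≤ N) : 2 ≤ N.choose r := by
  have h1 : (r + 1).choose r ≤ N.choose r := Nat.choose_le_choose r h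
  rw [Nat.choose_succ_self_right] at h1
  omega

/-- the case where `A` has no set containing the last point. -/
lemma cross_case {M L : ℕ} {A B : Finset (Finset ℕ)}
    (hA : A ⊆ Finset.powersetCard (L + 1) (Finset.range (M + 1)))
    (hB : B ⊆ Finset.powersetCard (L + 1) (Finset.range (M + 1)))
    (hr : Finset.range (L + 1) ∈ A)
    (h : Cross A B) (hM : 2 * L + 2 ≤ M) (hem : lk M A = ∅)
    (hb : (dl M A).card + (dl M B).card + (M - (L + 1)).choose (L + 1) ≤ M.choose (L + 1) + 1) :
    A.card + B.card + (M + 1 - (L + 1)).choose (L + 1) ≤ (M + 1).choose (L + 1) + 1 ∧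
    (1 ≤ L → 2 ≤ A.card →
      A.card + B.card + (M + 1 - (L + 1)).choose (L + 1) < (M + 1).choose (L + 1) + 1) := by
  have hBs := lk_sub (x := M) hB
  rw [range_erase] at hBs
  have hAM : ∀ a ∈ A, M ∉ a := by
    intro a ha hMa
    have : a.erase M ∈ lk M A := mem_lk.2 ⟨by simp, by rwa [Finset.insert_erase hMa]⟩
    simp [hem] at this
  have hmeet : ∀ a ∈ A, ∀ b ∈ lk M B, ∃ e, e ∈ b ∧ e ∈ a := by
    intro a ha b hb
    obtain ⟨e, h1, h2⟩ := h _ ha _ (mem_lk.1 hb).2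
    refine ⟨e, ?_, h1⟩
    have := hAM a ha
    grind
  have cA := card_lk_dl M A
  have cB := card_lk_dl M B
  rw [hem, Finset.card_empty] at cA
  have hsub : Finset.range (L + 1) ⊆ Finset.range M := Finset.range_subset_range.2 (by omega)
  have e1 : M + 1 - (L + 1) = (M - (L + 1)) + 1 := by omega
  have p1 := Nat.choose_succ_succ (M - (L + 1)) L
  have p2 := Nat.choose_succ_succ M L
  rw [Nat.succ_eq_add_one, Nat.succ_eq_add_one] at p1 p2
  rw [e1, p1, p2]
  constructor
  · have := card_le_meet (Finset.range M) (Finset.range (L + 1)) L hsub _ hBs (hmeet _ hr)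
    rw [Finset.card_range, Finset.card_range] at this
    omega
  · intro hL h2
    obtain ⟨a, ha, hane⟩ := Finset.exists_mem_ne (s := A) (by omega) (Finset.range (L + 1))
    obtain ⟨r, rfl⟩ : ∃ r, L = r + 1 := ⟨L - 1, by omega⟩
    have hac := Finset.mem_powersetCard.1 (hA ha)
    have := card_lt_meet (Finset.range M) (Finset.range (r + 1 + 1)) a r hsub
      (fun hc => hane (Finset.eq_of_subset_of_card_le hc (by simp [hac.2])).symm)
      (by rw [Finset.card_range]; omega) _ hBs (hmeet _ hr) (hmeet a ha)
    rw [Finset.card_range, Finset.card_range] at this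
    omega

lemma cross_range (m : ℕ) : ∀ l A B, A ⊆ Finset.powersetCard l (Finset.range m) →
    B ⊆ Finset.powersetCard l (Finset.range m) → A.Nonempty → B.Nonempty → Cross A B → 2 * l ≤ m →
    A.card + B.card + (m - l).choose l ≤ m.choose l + 1 ∧
    (3 ≤ l → 2 * l + 1 ≤ m → 2 ≤ A.card → 2 ≤ B.card →
      A.card + B.card + (m - l).choose l < m.choose l + 1) := by
  induction m with
  | zero =>
    intro l A B hA hB hAne hBne h hl
    exfalso
    obtain ⟨a, ha⟩ := hAne
    obtain ⟨b, hb⟩ := hBne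
    obtain ⟨e, he, -⟩ := h a ha b hb
    have := (Finset.mem_powersetCard.1 (hA ha)).1 he
    simp at this
  | succ M ih =>
    intro l A0 B0 hA0 hB0 hA0ne hB0ne h0 hl
    obtain ⟨A, B, ⟨cA0, cB0, hA, hB, h⟩, hsA, hsB⟩ := exists_stable (M + 1)
      (fun A B => A.card = A0.card ∧ B.card = B0.card ∧
        A ⊆ Finset.powersetCard l (Finset.range (M + 1)) ∧
        B ⊆ Finset.powersetCard l (Finset.range (M + 1)) ∧ Cross A B)
      (fun i j A B hij hj ⟨h1, h2, h3, h4, h5⟩ =>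
        ⟨by rw [card_sh, h1], by rw [card_sh, h2], sh_sub hij h3, sh_sub hij h4, cross_sh h5⟩)
      _ A0 B0 le_rfl ⟨rfl, rfl, hA0, hB0, h0⟩
    have hAne : A.Nonempty := by
      rw [← Finset.card_pos] at *; omega
    have hBne : B.Nonempty := by
      rw [← Finset.card_pos] at *; omega
    rw [← cA0, ← cB0]
    clear h0 hA0 hB0 cA0 cB0 hA0ne hB0ne A0 B0
    rcases Nat.eq_or_lt_of_le hl with heq | hlt
    · refine ⟨?_, fun _ h1 => by omega⟩
      have := card_compl (V := Finset.range (M + 1)) (by simp [heq]) hA hB h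
      rw [← heq]
      have e : 2 * l - l = l := by omega
      rw [e, Nat.choose_self]
      omega
    obtain ⟨L, rfl⟩ : ∃ L, l = L + 1 := by
      rcases l with _ | L
      · exfalso
        obtain ⟨a, ha⟩ := hAne
        obtain ⟨b, hb⟩ := hBne
        obtain ⟨e, he, -⟩ := h a ha b hb
        have := (Finset.mem_powersetCard.1 (hA ha)).2
        simp at this
        simp [this] at he
      · exact ⟨L, rfl⟩
    have rA := dl_nonempty hsA hA (by omega) hAne
    have rB := dl_nonempty hsB hB (by omega) hBne
    have dA := dl_sub (x := M) hA
    have dB := dl_sub (x := M) hB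
    have lA := lk_sub (x := M) hA
    have lB := lk_sub (x := M) hB
    rw [range_erase] at dA dB lA lB
    have ih1 := (ih (L + 1) _ _ dA dB ⟨_, rA⟩ ⟨_, rB⟩
      (fun a ha b hb => h a (mem_dl.1 ha).1 b (mem_dl.1 hb).1) (by omega)).1
    rcases Finset.eq_empty_or_nonempty (lk M A) with hem | hne
    · have := cross_case hA hB (mem_dl.1 rA).1 h (by omega) hem ih1
      exact ⟨this.1, fun h1 h2 h3 h4 => this.2 (by omega) h3⟩
    rcases Finset.eq_empty_or_nonempty (lk M B) with hem | hne2
    · have := cross_case hB hA (mem_dl.1 rB).1 h.symm (by omega) hem (by omega)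
      rw [add_comm A.card]
      exact ⟨this.1, fun h1 h2 h3 h4 => this.2 (by omega) h4⟩
    have hcl := cross_lk hsA hA hB h (by omega)
    have ih2 := (ih L _ _ lA lB hne hne2 hcl (by omega)).1
    obtain ⟨r, rfl⟩ : ∃ r, L = r + 1 := by
      rcases L with _ | L
      · exfalso
        obtain ⟨a, ha⟩ := hne
        obtain ⟨b, hb⟩ := hne2
        obtain ⟨e, he, -⟩ := hcl a ha b hb
        have := (Finset.mem_powersetCard.1 (lA ha)).2
        simp at this
        simp [this] at he
      · exact ⟨L, rfl⟩
    have cA := card_lk_dl M A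
    have cB := card_lk_dl M B
    obtain ⟨N, rfl⟩ : ∃ N, M = N + (r + 1 + 1) := ⟨M - (r + 1 + 1), by omega⟩
    have e1 : N + (r + 1 + 1) - (r + 1 + 1) = N := by omega
    have e2 : N + (r + 1 + 1) - (r + 1) = N + 1 := by omega
    have e3 : N + (r + 1 + 1) + 1 - (r + 1 + 1) = N + 1 := by omega
    rw [e1] at ih1
    rw [e2] at ih2
    rw [e3]
    have p1 := Nat.choose_succ_succ N (r + 1)
    have p2 := Nat.choose_succ_succ N r
    have p3 := Nat.choose_succ_succ (N + (r + 1 + 1)) (r + 1)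
    simp only [Nat.succ_eq_add_one] at p1 p2 p3
    have p4 : 0 < N.choose r := Nat.choose_pos (by omega)
    constructor
    · omega
    · intro h1 h2 h3 h4
      have := two_le_choose (N := N) (r := r) (by omega) (by omega)
      omega

section transfer
variable {α : Type*} [DecidableEq α]

lemma exists_label (V : Finset α) : ∃ f : α → ℕ, Set.InjOn f V ∧ V.image f = Finset.range V.card := by
  classical
  refine ⟨fun x => if h : x ∈ V then (V.equivFin ⟨x, h⟩ : ℕ) else 0, ?_, ?_⟩
  · intro x hx y hy h
    have hx' : x ∈ V := hx
    have hy' : y ∈ V := hy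
    simp only [hx', hy', dif_pos] at h
    have := V.equivFin.injective (Fin.ext h)
    simpa using this
  · ext e
    simp only [Finset.mem_image, Finset.mem_range]
    constructor
    · rintro ⟨x, hx, rfl⟩
      simp only [hx, dif_pos]
      exact (V.equivFin ⟨x, hx⟩).2
    · intro he
      refine ⟨(V.equivFin.symm ⟨e, he⟩ : V), (V.equivFin.symm ⟨e, he⟩).2, ?_⟩
      simp

def tr (f : α → ℕ) (F : Finset (Finset α)) : Finset (Finset ℕ) := F.image (fun S => S.image f)

lemma tr_sub {f : α → ℕ} {V : Finset α} (hf : Set.InjOn f V)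
    (hV : V.image f = Finset.range V.card) {k : ℕ} {F : Finset (Finset α)}
    (hF : F ⊆ Finset.powersetCard k V) :
    tr f F ⊆ Finset.powersetCard k (Finset.range V.card) := by
  intro T hT
  obtain ⟨S, hS, rfl⟩ := Finset.mem_image.1 hT
  have h := Finset.mem_powersetCard.1 (hF hS)
  rw [Finset.mem_powersetCard]
  refine ⟨by rw [← hV]; exact Finset.image_subset_image h.1, ?_⟩
  rw [Finset.card_image_of_injOn (hf.mono (by exact_mod_cast h.1)), h.2]

lemma tr_card {f : α → ℕ} {V : Finset α} (hf : Set.InjOn f V) {k : ℕ} {F : Finset (Finset α)}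
    (hF : F ⊆ Finset.powersetCard k V) : (tr f F).card = F.card := by
  apply Finset.card_image_of_injOn
  intro S hS T hT h
  have h1 := (Finset.mem_powersetCard.1 (hF hS)).1
  have h2 := (Finset.mem_powersetCard.1 (hF hT)).1
  have h' : S.image f = T.image f := h
  ext e
  constructor
  · intro he
    have : f e ∈ T.image f := h' ▸ Finset.mem_image_of_mem f he
    obtain ⟨e', he', hee⟩ := Finset.mem_image.1 this
    rwa [← hf (h2 he') (h1 he) hee]
  · intro he
    have : f e ∈ S.image f := h' ▸ Finset.mem_image_of_mem f he
    obtain ⟨e', he', hee⟩ := Finset.mem_image.1 this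
    rwa [← hf (h1 he') (h2 he) hee]

lemma tr_cross {f : α → ℕ} {A B : Finset (Finset α)} (h : Cross A B) : Cross (tr f A) (tr f B) := by
  intro a ha b hb
  obtain ⟨a, ha', rfl⟩ := Finset.mem_image.1 ha
  obtain ⟨b, hb', rfl⟩ := Finset.mem_image.1 hb
  obtain ⟨e, h1, h2⟩ := h a ha' b hb'
  exact ⟨f e, Finset.mem_image_of_mem f h1, Finset.mem_image_of_mem f h2⟩

lemma cross_gen (V : Finset α) {l : ℕ} {A B : Finset (Finset α)}
    (hA : A ⊆ Finset.powersetCard l V) (hB : B ⊆ Finset.powersetCard l V)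
    (hAne : A.Nonempty) (hBne : B.Nonempty) (h : Cross A B) (hl : 2 * l ≤ V.card) :
    A.card + B.card + (V.card - l).choose l ≤ V.card.choose l + 1 ∧
    (3 ≤ l → 2 * l + 1 ≤ V.card → 2 ≤ A.card → 2 ≤ B.card →
      A.card + B.card + (V.card - l).choose l < V.card.choose l + 1) := by
  obtain ⟨f, hf, hV⟩ := exists_label V
  have := cross_range V.card l _ _ (tr_sub hf hV hA) (tr_sub hf hV hB) (hAne.image _)
    (hBne.image _) (tr_cross h) hl
  rwa [tr_card hf hA, tr_card hf hB] at this

end transfer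

section graphs
variable {α : Type*} [DecidableEq α]

lemma star_of_three {V : Finset α} {A B : Finset (Finset α)} {z : α}
    (hA : A ⊆ Finset.powersetCard 2 V) (hB : B ⊆ Finset.powersetCard 2 V) (h : Cross A B)
    (hc : 3 ≤ A.card) (hz : ∀ a ∈ A, z ∈ a) : ∀ b ∈ B, z ∈ b := by
  intro b hb
  by_contra hzb
  obtain ⟨p, q, hpq, rfl⟩ := Finset.card_eq_two.1 (Finset.mem_powersetCard.1 (hB hb)).2
  have : A ⊆ {{z, p}, {z, q}} := by
    intro a ha
    obtain ⟨e, h1, h2⟩ := h a ha _ hb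
    have h3 := hz a ha
    have hac := (Finset.mem_powersetCard.1 (hA ha)).2
    have hez : z ≠ e := by rintro rfl; exact hzb h2
    have : ({z, e} : Finset α) = a := by
      apply Finset.eq_of_subset_of_card_le
      · intro x hx
        simp only [Finset.mem_insert, Finset.mem_singleton] at hx
        rcases hx with rfl | rfl <;> assumption
      · rw [hac, Finset.card_pair hez]
    rw [← this]
    simp only [Finset.mem_insert, Finset.mem_singleton] at h2 ⊢
    rcases h2 with rfl | rfl <;> simp
  have := Finset.card_le_card this
  have := Finset.card_le_two (a := ({z, p} : Finset α)) (b := {z, q})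
  omega

lemma le_three_of_sub {b1 b2 b3 : Finset α} {B : Finset (Finset α)} (h : B ⊆ {b1, b2, b3}) :
    B.card ≤ 3 := (Finset.card_le_card h).trans Finset.card_le_three

lemma pair_of_mem {V : Finset α} {B : Finset (Finset α)} (hB : B ⊆ Finset.powersetCard 2 V)
    {b : Finset α} (hb : b ∈ B) {u v : α} (hu : u ∈ b) (hv : v ∈ b) (huv : u ≠ v) : b = {u, v} := by
  symm
  apply Finset.eq_of_subset_of_card_le
  · intro x hx
    simp only [Finset.mem_insert, Finset.mem_singleton] at hx
    rcases hx with rfl | rfl <;> assumption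
  · rw [(Finset.mem_powersetCard.1 (hB hb)).2, Finset.card_pair huv]

lemma pair_other {e : Finset α} (h : e.card = 2) {a : α} (ha : a ∈ e) : ∃ b, b ≠ a ∧ e = {a, b} := by
  obtain ⟨p, q, hpq, rfl⟩ := Finset.card_eq_two.1 h
  simp only [Finset.mem_insert, Finset.mem_singleton] at ha
  rcases ha with rfl | rfl
  · exact ⟨q, hpq.symm, rfl⟩
  · exact ⟨p, hpq, Finset.pair_comm _ _⟩

lemma exists_sdiff {e f : Finset α} (h : e.card = 2) (h' : f.card = 2) (hne : e ≠ f) :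
    ∃ u ∈ e, u ∉ f := by
  apply Finset.not_subset.1
  intro hc
  exact hne (Finset.eq_of_subset_of_card_le hc (by omega))

/-- three edges without a common vertex have at most three covers of size two -/
lemma three_edges {V : Finset α} {B : Finset (Finset α)} {e1 e2 e3 : Finset α}
    (hB : B ⊆ Finset.powersetCard 2 V) (c1 : e1.card = 2) (c2 : e2.card = 2) (c3 : e3.card = 2)
    (h12 : e1 ≠ e2) (h13 : e1 ≠ e3) (h23 : e2 ≠ e3)
    (hno : ∀ z, ¬ (z ∈ e1 ∧ z ∈ e2 ∧ z ∈ e3))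
    (m1 : ∀ b ∈ B, ∃ e, e ∈ e1 ∧ e ∈ b) (m2 : ∀ b ∈ B, ∃ e, e ∈ e2 ∧ e ∈ b)
    (m3 : ∀ b ∈ B, ∃ e, e ∈ e3 ∧ e ∈ b) : B.card ≤ 3 := by
  by_cases hc : ∃ a, a ∈ e1 ∧ a ∈ e2
  · obtain ⟨a, ha1, ha2⟩ := hc
    obtain ⟨b, hb, rfl⟩ := pair_other c1 ha1
    obtain ⟨c, hc, rfl⟩ := pair_other c2 ha2
    obtain ⟨p, q, hpq, rfl⟩ := Finset.card_eq_two.1 c3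
    apply le_three_of_sub (b1 := {a, p}) (b2 := {a, q}) (b3 := {b, c})
    intro t ht
    obtain ⟨x, hx, hxt⟩ := m1 t ht
    obtain ⟨y, hy, hyt⟩ := m2 t ht
    obtain ⟨z, hz, hzt⟩ := m3 t ht
    have P := fun u v => pair_of_mem hB ht (u := u) (v := v)
    have hna := hno a
    have hbc : b ≠ c := by rintro rfl; exact h12 rfl
    simp only [Finset.mem_insert, Finset.mem_singleton] at *
    by_cases hat : a ∈ t
    · rcases hz with rfl | rfl
      · left; exact P a z hat hzt (by tauto)
      · right; left; exact P a z hat hzt (by tauto)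
    · right; right
      have hxb : x = b := by
        rcases hx with rfl | rfl
        · exact absurd hxt hat
        · rfl
      have hyc : y = c := by
        rcases hy with rfl | rfl
        · exact absurd hyt hat
        · rfl
      subst hxb hyc
      exact P _ _ hxt hyt hbc
  · push Not at hc
    obtain ⟨u, hu1, hu3⟩ := exists_sdiff c1 c3 h13
    obtain ⟨v, hv2, hv3⟩ := exists_sdiff c2 c3 h23
    obtain ⟨u', hu', rfl⟩ := pair_other c1 hu1
    obtain ⟨v', hv', rfl⟩ := pair_other c2 hv2
    apply le_three_of_sub (b1 := {u, v'}) (b2 := {u', v}) (b3 := {u', v'})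
    intro t ht
    obtain ⟨x, hx, hxt⟩ := m1 t ht
    obtain ⟨y, hy, hyt⟩ := m2 t ht
    obtain ⟨z, hz, hzt⟩ := m3 t ht
    have hxy : x ≠ y := by
      rintro rfl
      exact hc x hx hy
    have P := pair_of_mem hB ht hxt hyt hxy
    simp only [Finset.mem_insert, Finset.mem_singleton] at *
    rcases hx with rfl | rfl <;> rcases hy with rfl | rfl
    · exfalso
      rw [P] at hzt
      simp only [Finset.mem_insert, Finset.mem_singleton] at hzt
      rcases hzt with rfl | rfl
      · exact hu3 hz
      · exact hv3 hz
    · left; exact P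
    · right; left; exact P
    · right; right; exact P

lemma le_three_of_not_star {V : Finset α} {A B : Finset (Finset α)}
    (hA : A ⊆ Finset.powersetCard 2 V) (hB : B ⊆ Finset.powersetCard 2 V) (h : Cross A B)
    (hc : 3 ≤ A.card) (hns : ¬ ∃ z, ∀ a ∈ A, z ∈ a) : B.card ≤ 3 := by
  obtain ⟨e1, e2, e3, h1, h2, h3, h12, h13, h23⟩ := Finset.two_lt_card_iff.1 hc
  have C := fun a (ha : a ∈ A) => (Finset.mem_powersetCard.1 (hA ha)).2
  by_cases hz : ∃ z, z ∈ e1 ∧ z ∈ e2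
  · obtain ⟨z, hz1, hz2⟩ := hz
    push Not at hns
    obtain ⟨e4, h4, hz4⟩ := hns z
    refine three_edges hB (C e1 h1) (C e2 h2) (C e4 h4) h12 (by rintro rfl; exact hz4 hz1)
      (by rintro rfl; exact hz4 hz2) ?_ (h e1 h1) (h e2 h2) (h e4 h4)
    rintro w ⟨hw1, hw2, hw4⟩
    have hne : z ≠ w := by rintro rfl; exact hz4 hw4
    exact h12 ((pair_of_mem hA h1 hz1 hw1 hne).trans (pair_of_mem hA h2 hz2 hw2 hne).symm)
  · refine three_edges hB (C e1 h1) (C e2 h2) (C e3 h3) h12 h13 h23 ?_ (h e1 h1) (h e2 h2) (h e3 h3)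
    rintro w ⟨hw1, hw2, hw4⟩
    exact hz ⟨w, hw1, hw2⟩

lemma card_meet_two {V : Finset α} {A B : Finset (Finset α)}
    (hA : A ⊆ Finset.powersetCard 2 V) (hB : B ⊆ Finset.powersetCard 2 V) (h : Cross A B)
    (hV : 5 ≤ V.card) (hc : 2 ≤ A.card) : B.card ≤ V.card := by
  obtain ⟨e1, h1, e2, h2, h12⟩ := Finset.one_lt_card.1 hc
  have c1 := (Finset.mem_powersetCard.1 (hA h1)).2
  have c2 := (Finset.mem_powersetCard.1 (hA h2)).2
  by_cases hcm : ∃ a, a ∈ e1 ∧ a ∈ e2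
  · obtain ⟨a, ha1, ha2⟩ := hcm
    obtain ⟨b, hb, rfl⟩ := pair_other c1 ha1
    obtain ⟨c, hc, rfl⟩ := pair_other c2 ha2
    have haV : a ∈ V := (Finset.mem_powersetCard.1 (hA h1)).1 ha1
    have hbc : b ≠ c := by rintro rfl; exact h12 rfl
    have hsub : B ⊆ insert {b, c} ((V.erase a).image (fun x => ({a, x} : Finset α))) := by
      intro t ht
      have htc := Finset.mem_powersetCard.1 (hB ht)
      by_cases hat : a ∈ t
      · obtain ⟨x, hx, rfl⟩ := pair_other htc.2 hat
        refine Finset.mem_insert_of_mem (Finset.mem_image.2 ⟨x, ?_, rfl⟩)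
        exact Finset.mem_erase.2 ⟨hx, htc.1 (by simp)⟩
      · obtain ⟨x, hx, hxt⟩ := h _ h1 _ ht
        obtain ⟨y, hy, hyt⟩ := h _ h2 _ ht
        have hxb : x = b := by
          rcases Finset.mem_insert.1 hx with rfl | hx
          · exact absurd hxt hat
          · exact Finset.mem_singleton.1 hx
        have hyc : y = c := by
          rcases Finset.mem_insert.1 hy with rfl | hy
          · exact absurd hyt hat
          · exact Finset.mem_singleton.1 hy
        subst hxb hyc
        rw [pair_of_mem hB ht hxt hyt hbc]
        exact Finset.mem_insert_self _ _
    have k1 := Finset.card_le_card hsub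
    have k2 := Finset.card_insert_le ({b, c} : Finset α)
      ((V.erase a).image (fun x => ({a, x} : Finset α)))
    have k3 := Finset.card_image_le (s := V.erase a) (f := fun x => ({a, x} : Finset α))
    have k4 := Finset.card_erase_of_mem haV
    omega
  · obtain ⟨a, b, hab, rfl⟩ := Finset.card_eq_two.1 c1
    obtain ⟨c, d, hcd, rfl⟩ := Finset.card_eq_two.1 c2
    have hsub : B ⊆ {{a, c}, {a, d}, {b, c}, {b, d}} := by
      intro t ht
      obtain ⟨x, hx, hxt⟩ := h _ h1 _ ht
      obtain ⟨y, hy, hyt⟩ := h _ h2 _ ht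
      have hxy : x ≠ y := by
        rintro rfl
        exact hcm ⟨x, hx, hy⟩
      rw [pair_of_mem hB ht hxt hyt hxy]
      simp only [Finset.mem_insert, Finset.mem_singleton] at hx hy ⊢
      rcases hx with rfl | rfl <;> rcases hy with rfl | rfl <;> simp
    have k1 := Finset.card_le_card hsub
    have k2 := Finset.card_le_four (a := ({a, c} : Finset α)) (b := {a, d}) (c := {b, c}) (d := {b, d})
    omega

lemma graph_case {V : Finset α} {A B : Finset (Finset α)}
    (hA : A ⊆ Finset.powersetCard 2 V) (hB : B ⊆ Finset.powersetCard 2 V) (h : Cross A B)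
    (hV : 5 ≤ V.card) (hcA : 2 ≤ A.card) (hcB : 2 ≤ B.card)
    (ht : V.card.choose 2 + 1 ≤ A.card + B.card + (V.card - 2).choose 2) :
    ∃ z, (∀ a ∈ A, z ∈ a) ∧ (∀ b ∈ B, z ∈ b) := by
  have h1 := card_meet_two hA hB h hV hcA
  have h2 := card_meet_two hB hA h.symm hV hcB
  have hm : V.card.choose 2 + 3 = 2 * V.card + (V.card - 2).choose 2 := by
    obtain ⟨N, hN⟩ : ∃ N, V.card = N + 2 := ⟨V.card - 2, by omega⟩
    rw [hN]
    have p1 := Nat.choose_succ_succ (N + 1) 1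
    have p2 := Nat.choose_succ_succ N 1
    simp only [Nat.succ_eq_add_one, Nat.choose_one_right] at p1 p2
    rw [show N + 1 + 1 = N + 2 from rfl, show 1 + 1 = 2 from rfl] at p1
    rw [show 1 + 1 = 2 from rfl] at p2
    have : N + 2 - 2 = N := by omega
    rw [this]
    omega
  have hA3 : 3 ≤ A.card := by omega
  have hB3 : 3 ≤ B.card := by omega
  by_cases hs : ∃ z, ∀ a ∈ A, z ∈ a
  · obtain ⟨z, hz⟩ := hs
    exact ⟨z, hz, star_of_three hA hB h hA3 hz⟩
  by_cases hs2 : ∃ z, ∀ b ∈ B, z ∈ b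
  · obtain ⟨z, hz⟩ := hs2
    exact ⟨z, star_of_three hB hA h.symm hB3 hz, hz⟩
  have := le_three_of_not_star hA hB h hA3 hs
  have := le_three_of_not_star hB hA h.symm hB3 hs2
  omega

end graphs

section cover
variable {α : Type*} [DecidableEq α]

lemma decomp (x y : α) (F : Finset (Finset α)) : F.card = (lk y (lk x F)).card +
    (dl y (lk x F)).card + (lk y (dl x F)).card + (dl y (dl x F)).card := by
  have h1 := card_lk_dl x F
  have h2 := card_lk_dl y (lk x F)
  have h3 := card_lk_dl y (dl x F)
  omega

lemma cross_xy {F : Finset (Finset α)} (h : Cross F F) {x y : α} :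
    Cross (dl y (lk x F)) (lk y (dl x F)) := by
  intro a ha b hb
  obtain ⟨ha1, ha2⟩ := mem_dl.1 ha
  obtain ⟨ha3, ha4⟩ := mem_lk.1 ha1
  obtain ⟨hb1, hb2⟩ := mem_lk.1 hb
  obtain ⟨hb3, hb4⟩ := mem_dl.1 hb2
  obtain ⟨e, h1, h2⟩ := h _ ha4 _ hb3
  refine ⟨e, ?_, ?_⟩ <;> grind

lemma card_erase_two {V : Finset α} {x y : α} (hxy : x ≠ y) (hx : x ∈ V) (hy : y ∈ V) :
    ((V.erase x).erase y).card = V.card - 2 := by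
  rw [Finset.card_erase_of_mem (Finset.mem_erase.2 ⟨hxy.symm, hy⟩), Finset.card_erase_of_mem hx]
  omega

lemma pascal2 (n r : ℕ) (hn : 2 ≤ n) :
    (n - 1).choose (r + 1) = (n - 2).choose r + (n - 2).choose (r + 1) := by
  obtain ⟨N, rfl⟩ : ∃ N, n = N + 2 := ⟨n - 2, by omega⟩
  exact Nat.choose_succ_succ N r

/-- families with a cover of size two -/
lemma two_cover {V : Finset α} {F : Finset (Finset α)} {r : ℕ} (hr : 1 ≤ r)
    (hV : 2 * (r + 2) + 1 ≤ V.card) (hF : F ⊆ Finset.powersetCard (r + 2) V) (h : Cross F F)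
    (hnt : ∀ x, ∃ S ∈ F, x ∉ S) {x y : α} (hcov : ∀ S ∈ F, x ∈ S ∨ y ∈ S) :
    F.card + (V.card - (r + 3)).choose (r + 1) ≤ (V.card - 1).choose (r + 1) + 1 ∧
    ((V.card - 1).choose (r + 1) + 1 ≤ F.card + (V.card - (r + 3)).choose (r + 1) →
      (∃ z, ∃ G ∈ F, z ∉ G ∧ ∀ S ∈ F, S ≠ G → z ∈ S) ∨
      (r = 1 ∧ ∃ T : Finset α, T.card = 3 ∧ ∀ S ∈ F, 2 ≤ (S ∩ T).card)) := by
  obtain ⟨Sx, hSx, hxSx⟩ := hnt x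
  obtain ⟨Sy, hSy, hySy⟩ := hnt y
  have hySx : y ∈ Sx := (hcov _ hSx).resolve_left hxSx
  have hxSy : x ∈ Sy := (hcov _ hSy).resolve_right hySy
  have hxy : x ≠ y := by rintro rfl; exact hxSx hySx
  have hxV : x ∈ V := (Finset.mem_powersetCard.1 (hF hSy)).1 hxSy
  have hyV : y ∈ V := (Finset.mem_powersetCard.1 (hF hSx)).1 hySx
  have hW := card_erase_two hxy hxV hyV
  have hA : dl y (lk x F) ⊆ Finset.powersetCard (r + 1) ((V.erase x).erase y) := dl_sub (lk_sub hF)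
  have hB : lk y (dl x F) ⊆ Finset.powersetCard (r + 1) ((V.erase x).erase y) := lk_sub (dl_sub hF)
  have hC : lk y (lk x F) ⊆ Finset.powersetCard r ((V.erase x).erase y) := lk_sub (lk_sub hF)
  have hD : dl y (dl x F) = ∅ := by
    rw [Finset.eq_empty_iff_forall_notMem]
    intro S hS
    obtain ⟨h1, h2⟩ := mem_dl.1 hS
    obtain ⟨h3, h4⟩ := mem_dl.1 h1
    rcases hcov S h3 with h5 | h5 <;> contradiction
  have mA : ∀ S ∈ F, y ∉ S → S.erase x ∈ dl y (lk x F) := by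
    intro S hS hyS
    have hxS := (hcov _ hS).resolve_right hyS
    rw [mem_dl, mem_lk, Finset.insert_erase hxS]
    exact ⟨⟨by simp, hS⟩, by simp [hyS]⟩
  have mB : ∀ S ∈ F, x ∉ S → S.erase y ∈ lk y (dl x F) := by
    intro S hS hxS
    have hyS := (hcov _ hS).resolve_left hxS
    rw [mem_lk, mem_dl, Finset.insert_erase hyS]
    exact ⟨by simp, hS, hxS⟩
  have hAne : (dl y (lk x F)).Nonempty := ⟨_, mA _ hSy hySy⟩
  have hBne : (lk y (dl x F)).Nonempty := ⟨_, mB _ hSx hxSx⟩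
  have hcr := cross_xy h (x := x) (y := y)
  have main := cross_gen _ hA hB hAne hBne hcr (by omega)
  have cC := Finset.card_le_card hC
  rw [Finset.card_powersetCard, hW] at cC
  have dec := decomp x y F
  rw [hD, Finset.card_empty] at dec
  rw [hW, show V.card - 2 - (r + 1) = V.card - (r + 3) by omega] at main
  have pas := pascal2 V.card r (by omega)
  refine ⟨by omega, fun heq => ?_⟩
  by_cases hA1 : (dl y (lk x F)).card ≤ 1
  · left
    refine ⟨y, Sy, hSy, hySy, fun S hS hne => ?_⟩
    by_contra hyS
    apply hne
    have := Finset.card_le_one.1 hA1 _ (mA S hS hyS) _ (mA Sy hSy hySy)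
    rw [← Finset.insert_erase hxSy, ← this, Finset.insert_erase ((hcov _ hS).resolve_right hyS)]
  by_cases hB1 : (lk y (dl x F)).card ≤ 1
  · left
    refine ⟨x, Sx, hSx, hxSx, fun S hS hne => ?_⟩
    by_contra hxS
    apply hne
    have := Finset.card_le_one.1 hB1 _ (mB S hS hxS) _ (mB Sx hSx hxSx)
    rw [← Finset.insert_erase hySx, ← this, Finset.insert_erase ((hcov _ hS).resolve_left hxS)]
  by_cases hr2 : 2 ≤ r
  · have := main.2 (by omega) (by omega) (by omega) (by omega)
    omega
  right
  obtain rfl : r = 1 := by omega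
  refine ⟨rfl, ?_⟩
  have heq' : (V.card - 1).choose 2 + 1 ≤ F.card + (V.card - (1 + 3)).choose 2 := heq
  have pas' : (V.card - 1).choose 2 = (V.card - 2).choose 1 + (V.card - 2).choose 2 := pas
  obtain ⟨z, hzA, hzB⟩ := graph_case hA hB hcr (by omega) (by omega) (by omega)
    (by rw [hW, show V.card - 2 - 2 = V.card - (1 + 3) by omega]; omega)
  have z1 := hzA _ (mA _ hSy hySy)
  have z2 := hzB _ (mB _ hSx hxSx)
  have hzx : z ≠ x := by rintro rfl; simp at z1
  have hzy : z ≠ y := by rintro rfl; simp at z2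
  refine ⟨{x, y, z}, Finset.card_eq_three.2 ⟨x, y, z, hxy, hzx.symm, hzy.symm, rfl⟩, ?_⟩
  have hpair : ∀ S : Finset α, ∀ u v, u ≠ v → u ∈ S → v ∈ S → u ∈ ({x, y, z} : Finset α) →
      v ∈ ({x, y, z} : Finset α) → 2 ≤ (S ∩ {x, y, z}).card := by
    intro S u v huv hu hv hu' hv'
    exact Finset.one_lt_card.2 ⟨u, Finset.mem_inter.2 ⟨hu, hu'⟩, v, Finset.mem_inter.2 ⟨hv, hv'⟩, huv⟩
  intro S hS
  by_cases hxS : x ∈ S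
  · by_cases hyS : y ∈ S
    · exact hpair S x y hxy hxS hyS (by simp) (by simp)
    · exact hpair S x z hzx.symm hxS (Finset.mem_of_mem_erase (hzA _ (mA S hS hyS)))
        (by simp) (by simp)
  · exact hpair S y z hzy.symm ((hcov _ hS).resolve_left hxS)
      (Finset.mem_of_mem_erase (hzB _ (mB S hS hxS))) (by simp) (by simp)

/-- all members but one meet a pair, no cover of size two -/
lemma one_missing {V : Finset α} {F : Finset (Finset α)} {r : ℕ} (hr : 1 ≤ r)
    (hV : 2 * (r + 2) + 1 ≤ V.card) (hF : F ⊆ Finset.powersetCard (r + 2) V) (h : Cross F F)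
    (hnt : ∀ x y, ∃ S ∈ F, x ∉ S ∧ y ∉ S) {x y : α} (hxy : x ≠ y) {G : Finset α} (hG : G ∈ F)
    (hxG : x ∉ G) (hyG : y ∉ G) (hcov : ∀ S ∈ F, S ≠ G → x ∈ S ∨ y ∈ S) :
    F.card + (V.card - (r + 3)).choose (r + 1) < (V.card - 1).choose (r + 1) + 1 := by
  have hGc := Finset.mem_powersetCard.1 (hF hG)
  obtain ⟨g, hg⟩ : G.Nonempty := by rw [← Finset.card_pos]; omega
  obtain ⟨Sx, hSx, hxSx, hgx⟩ := hnt x g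
  obtain ⟨Sy, hSy, hySy, hgy⟩ := hnt y g
  have hySx : y ∈ Sx := (hcov _ hSx (by rintro rfl; exact hgx hg)).resolve_left hxSx
  have hxSy : x ∈ Sy := (hcov _ hSy (by rintro rfl; exact hgy hg)).resolve_right hySy
  have hxV : x ∈ V := (Finset.mem_powersetCard.1 (hF hSy)).1 hxSy
  have hyV : y ∈ V := (Finset.mem_powersetCard.1 (hF hSx)).1 hySx
  have hW := card_erase_two hxy hxV hyV
  have hA : dl y (lk x F) ⊆ Finset.powersetCard (r + 1) ((V.erase x).erase y) := dl_sub (lk_sub hF)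
  have hB : lk y (dl x F) ⊆ Finset.powersetCard (r + 1) ((V.erase x).erase y) := lk_sub (dl_sub hF)
  have hC : lk y (lk x F) ⊆ Finset.powersetCard r ((V.erase x).erase y) := lk_sub (lk_sub hF)
  have hD : dl y (dl x F) ⊆ {G} := by
    intro S hS
    obtain ⟨h1, h2⟩ := mem_dl.1 hS
    obtain ⟨h3, h4⟩ := mem_dl.1 h1
    by_contra hne
    rcases hcov S h3 (by simpa using hne) with h5 | h5 <;> contradiction
  have cD := Finset.card_le_card hD
  rw [Finset.card_singleton] at cD
  have hAne : (dl y (lk x F)).Nonempty := by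
    refine ⟨Sy.erase x, ?_⟩
    rw [mem_dl, mem_lk, Finset.insert_erase hxSy]
    exact ⟨⟨by simp, hSy⟩, by simp [hySy]⟩
  have hBne : (lk y (dl x F)).Nonempty := by
    refine ⟨Sx.erase y, ?_⟩
    rw [mem_lk, mem_dl, Finset.insert_erase hySx]
    exact ⟨by simp, hSx, hxSx⟩
  have main := (cross_gen _ hA hB hAne hBne (cross_xy h) (by omega)).1
  have cC := card_le_meet ((V.erase x).erase y) G r (by
      intro e he
      refine Finset.mem_erase.2 ⟨?_, Finset.mem_erase.2 ⟨?_, hGc.1 he⟩⟩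
      · rintro rfl; exact hyG he
      · rintro rfl; exact hxG he) _ hC (by
      intro S hS
      obtain ⟨h1, h2⟩ := mem_lk.1 hS
      obtain ⟨h3, h4⟩ := mem_lk.1 h2
      obtain ⟨e, h5, h6⟩ := h _ h4 _ hG
      refine ⟨e, ?_, h6⟩
      grind)
  have dec := decomp x y F
  rw [hW, hGc.2] at cC
  rw [hW, show V.card - 2 - (r + 1) = V.card - (r + 3) by omega] at main
  have pas := pascal2 V.card r (by omega)
  have := two_le_choose (N := V.card - 2 - (r + 2)) (r := r) hr (by omega)
  omega

end cover

lemma mv_cases (i j : ℕ) (F : Finset (Finset ℕ)) (S : Finset ℕ) :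
    mv i j F S = S ∨ (j ∈ S ∧ i ∉ S ∧ mv i j F S = insert i (S.erase j)) := by
  unfold mv
  split_ifs with h
  · right; exact ⟨h.1, h.2.1, rfl⟩
  · left; rfl

lemma mem_sh {i j : ℕ} {F : Finset (Finset ℕ)} {S : Finset ℕ} (hS : S ∈ F) :
    mv i j F S ∈ sh i j F := Finset.mem_image_of_mem _ hS

/-- shifting from a family with no cover of size two to one with a cover of size two. -/
lemma sh_cover {n r i j : ℕ} {F : Finset (Finset ℕ)} (hr : 1 ≤ r) (hij : i < j)
    (hn : 2 * (r + 2) + 1 ≤ n) (hF : F ⊆ Finset.powersetCard (r + 2) (Finset.range n))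
    (h : Cross F F) (hnt : ∀ x y, ∃ S ∈ F, x ∉ S ∧ y ∉ S) {x y : ℕ}
    (hcov : ∀ S ∈ sh i j F, x ∈ S ∨ y ∈ S) :
    F.card + (n - (r + 3)).choose (r + 1) < (n - 1).choose (r + 1) + 1 := by
  have hF' := sh_sub hij hF
  have h' := cross_sh (i := i) (j := j) h
  -- covers of the shifted family
  have cov1 : ∀ u v, u ≠ i → u ≠ j → v ≠ i → v ≠ j → ∃ S ∈ sh i j F, u ∉ S ∧ v ∉ S := by
    intro u v h1 h2 h3 h4
    obtain ⟨S, hS, hu, hv⟩ := hnt u v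
    refine ⟨_, mem_sh hS, ?_⟩
    rcases mv_cases i j F S with h5 | ⟨h5, h6, h7⟩
    · rw [h5]; exact ⟨hu, hv⟩
    · rw [h7]; constructor <;> grind
  have cov2 : ∃ S ∈ sh i j F, i ∉ S ∧ j ∉ S := by
    obtain ⟨S, hS, hu, hv⟩ := hnt i j
    refine ⟨_, mem_sh hS, ?_⟩
    rcases mv_cases i j F S with h5 | ⟨h5, h6, h7⟩
    · rw [h5]; exact ⟨hu, hv⟩
    · contradiction
  have hnt' : ∀ x, ∃ S ∈ sh i j F, x ∉ S := by
    intro u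
    by_cases hu : u = i
    · obtain ⟨S, hS, h1, h2⟩ := cov2
      exact ⟨S, hS, hu ▸ h1⟩
    by_cases hu2 : u = j
    · obtain ⟨S, hS, h1, h2⟩ := cov2
      exact ⟨S, hS, hu2 ▸ h2⟩
    obtain ⟨S, hS, h1, h2⟩ := cov1 u u hu hu2 hu hu2
    exact ⟨S, hS, h1⟩
  have main := two_cover hr (by simpa using hn) hF' h' hnt' hcov
  rw [Finset.card_range, card_sh] at main
  by_contra hlt
  rcases main.2 (by omega) with ⟨z, G, hG, hzG, hz⟩ | ⟨-, T, hT, hST⟩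
  · have hGc := (Finset.mem_powersetCard.1 (hF' hG)).2
    by_cases hzij : z ≠ i ∧ z ≠ j
    · have : ∃ y ∈ G, y ∉ ({i, j} : Finset ℕ) := by
        apply Finset.exists_mem_notMem_of_card_lt_card
        have := Finset.card_le_two (a := i) (b := j)
        omega
      obtain ⟨y, hy, hyij⟩ := this
      simp only [Finset.mem_insert, Finset.mem_singleton, not_or] at hyij
      obtain ⟨S, hS, h1, h2⟩ := cov1 z y hzij.1 hzij.2 hyij.1 hyij.2
      exact h1 (hz S hS (by rintro rfl; exact h2 hy))
    · have hzij' : z = i ∨ z = j := by tauto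
      obtain ⟨S, hS, h1, h2⟩ := cov2
      have hSG : S = G := by
        by_contra hne
        have := hz S hS hne
        rcases hzij' with rfl | rfl <;> contradiction
      subst hSG
      obtain ⟨S0, hS0, hS0'⟩ := Finset.mem_image.1 hG
      have hS0S : S0 = S := by
        rcases mv_cases i j F S0 with h5 | ⟨h5, h6, h7⟩
        · rw [← hS0', h5]
        · exfalso
          rw [← hS0', h7] at h1
          simp at h1
      subst hS0S
      apply hlt
      have := one_missing hr (by simpa using hn) hF h hnt (ne_of_lt hij) hS0 h1 h2 (by
        intro S hS hne
        by_contra hc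
        push Not at hc
        have hSm : mv i j F S = S := by
          rcases mv_cases i j F S with h5 | ⟨h5, h6, h7⟩
          · exact h5
          · exact absurd h5 hc.2
        have := hz S (hSm ▸ mem_sh hS) hne
        rcases hzij' with rfl | rfl
        · exact hc.1 this
        · exact hc.2 this)
      rwa [Finset.card_range] at this
  · have two : ∀ u v, u ≠ v → u ∈ T → v ∈ T → ∀ S ∈ sh i j F, ¬ (u ∉ S ∧ v ∉ S) := by
      rintro u v huv hu hv S hS ⟨h1, h2⟩
      have e1 : S ∩ T ⊆ (T.erase u).erase v := by
        intro e he
        obtain ⟨he1, he2⟩ := Finset.mem_inter.1 he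
        refine Finset.mem_erase.2 ⟨?_, Finset.mem_erase.2 ⟨?_, he2⟩⟩
        · rintro rfl; exact h2 he1
        · rintro rfl; exact h1 he1
      have e2 := Finset.card_le_card e1
      rw [card_erase_two huv hu hv] at e2
      have := hST S hS
      omega
    by_cases hTij : i ∈ T ∧ j ∈ T
    · obtain ⟨S, hS, h1⟩ := cov2
      exact two i j (ne_of_lt hij) hTij.1 hTij.2 S hS h1
    · have : 1 < (T \ {i, j}).card := by
        have e1 : ∃ w, T \ {i, j} = T.erase w := by
          by_cases hi : i ∈ T
          · refine ⟨i, ?_⟩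
            ext e
            simp only [Finset.mem_sdiff, Finset.mem_insert, Finset.mem_singleton, Finset.mem_erase]
            grind
          · refine ⟨j, ?_⟩
            ext e
            simp only [Finset.mem_sdiff, Finset.mem_insert, Finset.mem_singleton, Finset.mem_erase]
            grind
        obtain ⟨w, hw⟩ := e1
        rw [hw]
        have := Finset.pred_card_le_card_erase (a := w) (s := T)
        omega
      obtain ⟨u, hu, v, hv, huv⟩ := Finset.one_lt_card.1 this
      simp only [Finset.mem_sdiff, Finset.mem_insert, Finset.mem_singleton, not_or] at hu hv
      obtain ⟨S, hS, h1⟩ := cov1 u v hu.2.1 hu.2.2 hv.2.1 hv.2.2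
      exact two u v huv hu.1 hv.1 S hS h1

/-- the bound -/
def Bd (n : ℕ) : Prop := ∀ r F, 1 ≤ r → 2 * (r + 2) ≤ n →
  F ⊆ Finset.powersetCard (r + 2) (Finset.range n) → Cross F F → (∀ x, ∃ S ∈ F, x ∉ S) →
  F.card + (n - (r + 3)).choose (r + 1) ≤ (n - 1).choose (r + 1) + 1

lemma stable_bd {M r : ℕ} {F : Finset (Finset ℕ)} (hr : 1 ≤ r) (hn : 2 * (r + 2) ≤ M)
    (hF : F ⊆ Finset.powersetCard (r + 2) (Finset.range (M + 1)))
    (h : Cross F F) (hnt : ∀ x y, ∃ S ∈ F, x ∉ S ∧ y ∉ S) (hst : Stable (M + 1) F)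
    (ih : Bd M) :
    F.card + (M + 1 - (r + 3)).choose (r + 1) < (M + 1 - 1).choose (r + 1) + 1 := by
  have hI2 : Finset.Ico 2 (2 + (r + 2)) ∈ F := by
    obtain ⟨S, hS, h0, h1⟩ := hnt 0 1
    refine stable_min hst hF _ S hS le_rfl ?_
    intro x hx
    by_contra hc
    have : x = 0 ∨ x = 1 := by omega
    rcases this with rfl | rfl <;> contradiction
  have hI1 : Finset.Ico 1 (1 + (r + 2)) ∈ F := by
    refine stable_min hst hF _ _ hI2 le_rfl ?_
    intro x hx
    rw [Finset.mem_Ico] at hx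
    omega
  have hd := dl_sub (x := M) hF
  have hl := lk_sub (x := M) hF
  rw [range_erase] at hd hl
  have cF := card_lk_dl M F
  -- the deletion
  have bd1 := ih r (dl M F) hr hn hd (fun a ha b hb => h a (mem_dl.1 ha).1 b (mem_dl.1 hb).1) (by
    intro x
    by_cases hx : x ∈ Finset.Ico 2 (2 + (r + 2))
    · have hx' := Finset.mem_Ico.1 hx
      refine ⟨_, mem_dl.2 ⟨hst 0 x (by omega) (by omega) _ hI2 hx (by simp), ?_⟩, ?_⟩
      · simp only [Finset.mem_insert, Finset.mem_erase, Finset.mem_Ico]; omega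
      · simp only [Finset.mem_insert, Finset.mem_erase, Finset.mem_Ico]; omega
    · exact ⟨_, mem_dl.2 ⟨hI2, by rw [Finset.mem_Ico]; omega⟩, hx⟩)
  have e0 : M + 1 - 1 = M := by omega
  have e1 : M + 1 - (r + 3) = (M - (r + 3)) + 1 := by omega
  rw [e0, e1]
  have p1 := Nat.choose_succ_succ (M - (r + 3)) r
  have p2 := Nat.choose_succ_succ (M - 1) r
  rw [Nat.succ_eq_add_one, Nat.succ_eq_add_one] at p1 p2
  rw [show M - 1 + 1 = M by omega] at p2
  by_cases htr : ∀ S ∈ F, M ∈ S → 0 ∈ S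
  · -- every set through the last point contains `0`
    have l0 := lk_sub (x := 0) hl
    have c0 := card_lk_dl 0 (lk M F)
    have hd0 : dl 0 (lk M F) = ∅ := by
      rw [Finset.eq_empty_iff_forall_notMem]
      intro S hS
      obtain ⟨h1, h2⟩ := mem_dl.1 hS
      obtain ⟨h3, h4⟩ := mem_lk.1 h1
      have := htr _ h4 (by simp)
      rw [Finset.mem_insert] at this
      rcases this with h5 | h5
      · omega
      · contradiction
    rw [hd0, Finset.card_empty] at c0
    have meet : ∀ X ∈ F, 0 ∉ X → M ∉ X → ∀ S ∈ lk 0 (lk M F), ∃ e, e ∈ S ∧ e ∈ X := by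
      intro X hX hX0 hXM S hS
      obtain ⟨h1, h2⟩ := mem_lk.1 hS
      obtain ⟨h3, h4⟩ := mem_lk.1 h2
      obtain ⟨e, h5, h6⟩ := h _ h4 _ hX
      refine ⟨e, ?_, h6⟩
      grind
    have cU : ((Finset.range M).erase 0).card = M - 1 := by
      rw [Finset.card_erase_of_mem (Finset.mem_range.2 (by omega)), Finset.card_range]
    obtain ⟨s, rfl⟩ : ∃ s, r = s + 1 := ⟨r - 1, by omega⟩
    have := card_lt_meet ((Finset.range M).erase 0) (Finset.Ico 1 (1 + (s + 1 + 2)))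
      (Finset.Ico 2 (2 + (s + 1 + 2))) s (by
        intro e he
        rw [Finset.mem_Ico] at he
        rw [Finset.mem_erase, Finset.mem_range]
        omega) (by
        intro hc
        have := hc (Finset.mem_Ico.2 ⟨le_refl 1, by omega⟩)
        rw [Finset.mem_Ico] at this
        omega) (by rw [cU, Nat.card_Ico]; omega) _ l0
        (meet _ hI1 (by simp) (by rw [Finset.mem_Ico]; omega))
        (meet _ hI2 (by simp) (by rw [Finset.mem_Ico]; omega))
    rw [cU, Nat.card_Ico, show M - 1 - (1 + (s + 1 + 2) - 1) = M - (s + 1 + 3) by omega] at this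
    omega
  · push Not at htr
    obtain ⟨S0, hS0, hMS0, h0S0⟩ := htr
    have hS0l : S0.erase M ∈ lk M F := mem_lk.2 ⟨by simp, by rwa [Finset.insert_erase hMS0]⟩
    by_cases hr2 : 2 ≤ r
    · obtain ⟨s, rfl⟩ : ∃ s, r = s + 1 := ⟨r - 1, by omega⟩
      have bd2 := ih s (lk M F) (by omega) (by omega) hl (cross_lk hst hF hF h (by omega)) (by
        intro x
        by_cases hx : x ∈ S0.erase M
        · have hx0 : 0 < x := by
            rcases Nat.eq_zero_or_pos x with rfl | h1
            · exact absurd (Finset.mem_of_mem_erase hx) h0S0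
            · exact h1
          have hxM : x < M := by
            have := (Finset.mem_powersetCard.1 (hl hS0l)).1 hx
            simpa using this
          refine ⟨_, stable_lk hst 0 x hx0 hxM _ hS0l hx (by simp [h0S0]), ?_⟩
          simp only [Finset.mem_insert, Finset.mem_erase]
          omega
        · exact ⟨_, hS0l, hx⟩)
      have e3 : M - (s + 3) = M - (s + 1 + 3) + 1 := by omega
      rw [e3] at bd2
      have p3 := Nat.choose_succ_succ (M - (s + 1 + 3)) s
      rw [Nat.succ_eq_add_one, Nat.succ_eq_add_one] at p3
      have := two_le_choose (N := M - (s + 1 + 3)) (r := s) (by omega) (by omega)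
      omega
    · exfalso
      obtain rfl : r = 1 := by omega
      have := stable_min (t := 0) (stable_lk hst) hl _ _ hS0l le_rfl (by simp)
      obtain ⟨e, he1, he2⟩ := h _ (mem_lk.1 this).2 _ hI2
      simp only [Finset.mem_insert, Finset.mem_Ico] at he1 he2
      omega

lemma no_cover_bd {M r : ℕ} {F : Finset (Finset ℕ)} (hr : 1 ≤ r) (hn : 2 * (r + 2) ≤ M)
    (hF : F ⊆ Finset.powersetCard (r + 2) (Finset.range (M + 1)))
    (h : Cross F F) (hnt : ∀ x y, ∃ S ∈ F, x ∉ S ∧ y ∉ S) (ih : Bd M) :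
    F.card + (M + 1 - (r + 3)).choose (r + 1) < (M + 1 - 1).choose (r + 1) + 1 := by
  by_contra hlt
  obtain ⟨A, B, ⟨c1, h1, h2, h3, -⟩, hs, -⟩ := exists_stable (M + 1)
    (fun A B => A.card = F.card ∧ A ⊆ Finset.powersetCard (r + 2) (Finset.range (M + 1)) ∧
      Cross A A ∧ (∀ x y, ∃ S ∈ A, x ∉ S ∧ y ∉ S) ∧ B = ∅) (by
      rintro i j A B hij hj ⟨c1, h1, h2, h3, rfl⟩
      refine ⟨by rw [card_sh, c1], sh_sub hij h1, cross_sh h2, ?_, by simp [sh]⟩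
      by_contra hc
      push Not at hc
      obtain ⟨x, y, hxy⟩ := hc
      have := sh_cover (n := M + 1) hr hij (by omega) h1 h2 h3 (x := x) (y := y) (by
        intro S hS
        have := hxy S hS
        tauto)
      omega) _ F ∅ le_rfl ⟨rfl, hF, h, hnt, rfl⟩
  have := stable_bd hr hn h1 h2 h3 hs ih
  omega

lemma bd_all (n : ℕ) : Bd n := by
  induction n with
  | zero => intro r F hr hn; omega
  | succ M ih =>
    intro r F hr hn hF h hnt
    rcases Nat.eq_or_lt_of_le hn with heq | hlt
    · have := card_compl (V := Finset.range (M + 1)) (by simp [heq]) hF hF h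
      have e1 : M + 1 - (r + 3) = r + 1 := by omega
      have e2 : 2 * (r + 2) = (M + 1 - 1) + 1 := by omega
      have p := Nat.choose_succ_succ (M + 1 - 1) (r + 1)
      have q : (M + 1 - 1).choose (r + 1) = (M + 1 - 1).choose (r + 1 + 1) :=
        Nat.choose_symm_of_eq_add (by omega)
      rw [Nat.succ_eq_add_one, Nat.succ_eq_add_one] at p
      rw [e1, Nat.choose_self]
      rw [e2] at this
      have this' : F.card + F.card ≤ (M + 1 - 1 + 1).choose (r + 1 + 1) := this
      omega
    · by_cases hc : ∀ x y, ∃ S ∈ F, x ∉ S ∧ y ∉ S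
      · exact (no_cover_bd hr (by omega) hF h hc ih).le
      · push Not at hc
        obtain ⟨x, y, hxy⟩ := hc
        have := (two_cover hr (by rw [Finset.card_range]; omega) hF h hnt (x := x) (y := y) (by
          intro S hS
          have := hxy S hS
          tauto)).1
        rwa [Finset.card_range] at this

lemma no_cover_gen {Ω : Type*} [Fintype Ω] [DecidableEq Ω] {r : ℕ} {F : Finset (Finset Ω)}
    (hr : 1 ≤ r) (hn : 2 * (r + 2) + 1 ≤ Fintype.card Ω)
    (hF : F ⊆ Finset.powersetCard (r + 2) Finset.univ)
    (h : Cross F F) (hnt : ∀ x y, ∃ S ∈ F, x ∉ S ∧ y ∉ S) :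
    F.card + (Fintype.card Ω - (r + 3)).choose (r + 1) < (Fintype.card Ω - 1).choose (r + 1) + 1 := by
  obtain ⟨f, hf, hV⟩ := exists_label (Finset.univ : Finset Ω)
  have hinj : Function.Injective f := by
    intro x y hxy
    exact hf (by simp) (by simp) hxy
  have h1 := tr_sub hf hV hF
  have h2 := tr_card hf hF
  have hne : Nonempty Ω := by
    rw [← Fintype.card_pos_iff]; omega
  have hp : ∀ p, ∃ x, ∀ S ∈ F, x ∉ S → p ∉ S.image f := by
    intro p
    by_cases hp : ∃ x, f x = p
    · obtain ⟨x, rfl⟩ := hp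
      refine ⟨x, fun S _ hx hc => hx ?_⟩
      obtain ⟨y, hy, hyx⟩ := Finset.mem_image.1 hc
      exact hinj hyx ▸ hy
    · refine ⟨hne.some, fun S _ _ hc => hp ?_⟩
      obtain ⟨y, hy, hyx⟩ := Finset.mem_image.1 hc
      exact ⟨y, hyx⟩
  obtain ⟨M, hM⟩ : ∃ M, Fintype.card Ω = M + 1 := ⟨Fintype.card Ω - 1, by omega⟩
  rw [Finset.card_univ, hM] at h1
  rw [hM, ← h2]
  refine no_cover_bd hr (by omega) h1 (tr_cross h) ?_ (bd_all M)
  intro p q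
  obtain ⟨x, hx⟩ := hp p
  obtain ⟨y, hy⟩ := hp q
  obtain ⟨S, hS, h3, h4⟩ := hnt x y
  exact ⟨S.image f, Finset.mem_image_of_mem _ hS, hx S hS h3, hy S hS h4⟩

section counts
variable {Ω : Type*} [Fintype Ω] [DecidableEq Ω]

lemma count_hm {r : ℕ} {F : Finset Ω} {x : Ω} (hF : F.card = r + 1) (hx : x ∉ F) :
    (insert F ((Finset.powersetCard (r + 1) Finset.univ).filter
      (fun G => x ∈ G ∧ (G ∩ F).Nonempty))).card + (Fintype.card Ω - 1 - (r + 1)).choose r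
      = (Fintype.card Ω - 1).choose r + 1 := by
  have cU : (Finset.univ.erase x).card = Fintype.card Ω - 1 := by
    rw [Finset.card_erase_of_mem (Finset.mem_univ x), Finset.card_univ]
  have := card_meet (Finset.univ.erase x) F r (by
    intro e he
    refine Finset.mem_erase.2 ⟨?_, Finset.mem_univ e⟩
    rintro rfl
    exact hx he)
  rw [cU, hF] at this
  rw [Finset.card_insert_of_notMem (by simp [hx]), ← this]
  rw [card_lk_dl x ((Finset.powersetCard (r + 1) Finset.univ).filter
      (fun G => x ∈ G ∧ (G ∩ F).Nonempty))]
  have h1 : dl x ((Finset.powersetCard (r + 1) Finset.univ).filter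
      (fun G => x ∈ G ∧ (G ∩ F).Nonempty)) = ∅ := by
    rw [Finset.eq_empty_iff_forall_notMem]
    intro S hS
    have := mem_dl.1 hS
    simp only [Finset.mem_filter] at this
    tauto
  have h2 : lk x ((Finset.powersetCard (r + 1) Finset.univ).filter
      (fun G => x ∈ G ∧ (G ∩ F).Nonempty)) = (Finset.powersetCard r (Finset.univ.erase x)).filter
        (fun S => ∃ e, e ∈ S ∧ e ∈ F) := by
    ext S
    rw [mem_lk, Finset.mem_filter, Finset.mem_filter, Finset.mem_powersetCard,
      Finset.mem_powersetCard]
    constructor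
    · rintro ⟨h1, ⟨-, h2⟩, -, e, he⟩
      rw [Finset.card_insert_of_notMem h1] at h2
      obtain ⟨h3, h4⟩ := Finset.mem_inter.1 he
      refine ⟨⟨?_, by omega⟩, e, ?_, h4⟩
      · intro a ha
        refine Finset.mem_erase.2 ⟨?_, Finset.mem_univ a⟩
        rintro rfl
        exact h1 ha
      · rcases Finset.mem_insert.1 h3 with rfl | h3
        · contradiction
        · exact h3
    · rintro ⟨⟨h1, h2⟩, e, h3, h4⟩
      have hxS : x ∉ S := fun hc => by simpa using h1 hc
      refine ⟨hxS, ⟨Finset.subset_univ _, ?_⟩, by simp, e, ?_⟩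
      · rw [Finset.card_insert_of_notMem hxS, h2]
      · exact Finset.mem_inter.2 ⟨Finset.mem_insert_of_mem h3, h4⟩
  rw [h1, h2, Finset.card_empty]
  omega

lemma two_le_inter {x y z : Ω} (hxy : x ≠ y) (hxz : x ≠ z) (hyz : y ≠ z) (S : Finset Ω) :
    2 ≤ (S ∩ {x, y, z}).card ↔ (x ∈ S ∧ y ∈ S) ∨ (x ∈ S ∧ z ∈ S) ∨ (y ∈ S ∧ z ∈ S) := by
  by_cases hx : x ∈ S <;> by_cases hy : y ∈ S <;> by_cases hz : z ∈ S <;>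
    simp [Finset.inter_insert_of_mem, Finset.inter_insert_of_notMem, hx, hy, hz, hxy, hxz, hyz]

lemma count_tri {T : Finset Ω} (hT : T.card = 3) (hn : 7 ≤ Fintype.card Ω) :
    ((Finset.powersetCard 3 Finset.univ).filter (fun G => 2 ≤ (G ∩ T).card)).card
      + (Fintype.card Ω - 1 - 3).choose 2 = (Fintype.card Ω - 1).choose 2 + 1 := by
  obtain ⟨x, y, z, hxy, hxz, hyz, rfl⟩ := Finset.card_eq_three.1 hT
  simp only [two_le_inter hxy hxz hyz]
  set F := (Finset.powersetCard 3 Finset.univ).filter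
    (fun G : Finset Ω => (x ∈ G ∧ y ∈ G) ∨ (x ∈ G ∧ z ∈ G) ∨ (y ∈ G ∧ z ∈ G)) with hFdef
  have hF : F ⊆ Finset.powersetCard (1 + 2) Finset.univ := Finset.filter_subset _ _
  have memF : ∀ S, S ∈ F ↔ S.card = 3 ∧
      ((x ∈ S ∧ y ∈ S) ∨ (x ∈ S ∧ z ∈ S) ∨ (y ∈ S ∧ z ∈ S)) := by
    intro S
    rw [hFdef, Finset.mem_filter, Finset.mem_powersetCard]
    simp
  have hW := card_erase_two (V := Finset.univ) hxy (Finset.mem_univ x) (Finset.mem_univ y)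
  rw [Finset.card_univ] at hW
  set W := (Finset.univ.erase x).erase y with hWdef
  have memW : ∀ e, e ∈ W ↔ e ≠ y ∧ e ≠ x := by
    intro e; simp [hWdef]
  have hzW : ({z} : Finset Ω) ⊆ W := by
    rw [Finset.singleton_subset_iff, memW]
    exact ⟨hyz.symm, hxz.symm⟩
  have subW : ∀ S : Finset Ω, S ⊆ W ↔ x ∉ S ∧ y ∉ S := by
    intro S
    constructor
    · intro h
      exact ⟨fun hc => ((memW _).1 (h hc)).2 rfl, fun hc => ((memW _).1 (h hc)).1 rfl⟩
    · rintro ⟨h1, h2⟩ e he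
      rw [memW]
      constructor
      · rintro rfl; exact h2 he
      · rintro rfl; exact h1 he
  have hC : lk y (lk x F) = Finset.powersetCard 1 W := by
    apply Finset.Subset.antisymm (lk_sub (lk_sub hF))
    intro S hS
    obtain ⟨h1, h2⟩ := Finset.mem_powersetCard.1 hS
    obtain ⟨h3, h4⟩ := (subW S).1 h1
    have h5 : x ∉ insert y S := by simp [h3, hxy]
    rw [mem_lk, mem_lk, memF, Finset.card_insert_of_notMem h5, Finset.card_insert_of_notMem h4, h2]
    refine ⟨h4, h5, rfl, by simp⟩
  have hA : dl y (lk x F) = (Finset.powersetCard 2 W).filter (fun S => ∃ e, e ∈ S ∧ e ∈ ({z} : Finset Ω)) := by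
    ext S
    rw [mem_dl, mem_lk, memF, Finset.mem_filter, Finset.mem_powersetCard, subW]
    simp only [Finset.mem_singleton, exists_eq_right]
    constructor
    · rintro ⟨⟨h1, h2, h3⟩, h4⟩
      rw [Finset.card_insert_of_notMem h1] at h2
      refine ⟨⟨⟨h1, h4⟩, by omega⟩, ?_⟩
      grind
    · rintro ⟨⟨⟨h1, h4⟩, h2⟩, h3⟩
      rw [Finset.card_insert_of_notMem h1]
      refine ⟨⟨h1, by omega, ?_⟩, h4⟩
      grind
  have hB : lk y (dl x F) = (Finset.powersetCard 2 W).filter (fun S => ∃ e, e ∈ S ∧ e ∈ ({z} : Finset Ω)) := by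
    ext S
    rw [mem_lk, mem_dl, memF, Finset.mem_filter, Finset.mem_powersetCard, subW]
    simp only [Finset.mem_singleton, exists_eq_right]
    constructor
    · rintro ⟨h1, ⟨h2, h3⟩, h4⟩
      rw [Finset.card_insert_of_notMem h1] at h2
      refine ⟨⟨⟨?_, h1⟩, by omega⟩, ?_⟩ <;> grind
    · rintro ⟨⟨⟨h4, h1⟩, h2⟩, h3⟩
      rw [Finset.card_insert_of_notMem h1]
      refine ⟨h1, ⟨by omega, ?_⟩, ?_⟩ <;> grind
  have hD : dl y (dl x F) = ∅ := by
    rw [Finset.eq_empty_iff_forall_notMem]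
    intro S hS
    rw [mem_dl, mem_dl, memF] at hS
    tauto
  have dec := decomp x y F
  have cm := card_meet W {z} 2 hzW
  rw [hC, hA, hB, hD, Finset.card_powersetCard, Finset.card_empty, Nat.choose_one_right] at dec
  rw [Finset.card_singleton] at cm
  obtain ⟨N, hN⟩ : ∃ N, Fintype.card Ω = N + 4 := ⟨Fintype.card Ω - 4, by omega⟩
  rw [hN] at hW ⊢
  rw [hW] at dec cm
  rw [show N + 4 - 2 = N + 2 by omega] at dec cm
  rw [show N + 2 - 1 = N + 1 by omega] at cm
  rw [show N + 4 - 1 - 3 = N by omega, show N + 4 - 1 = N + 3 by omega]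
  have p1 : (N + 3).choose 2 = (N + 2).choose 1 + (N + 2).choose 2 := Nat.choose_succ_succ (N + 2) 1
  have p2 : (N + 2).choose 2 = (N + 1).choose 1 + (N + 1).choose 2 := Nat.choose_succ_succ (N + 1) 1
  have p3 : (N + 1).choose 2 = N.choose 1 + N.choose 2 := Nat.choose_succ_succ N 1
  rw [Nat.choose_one_right] at p1 p2 p3
  omega

end counts

end HMAux

open HMAux in
/-- **Hilton–Milner theorem.** Let `Ω` have cardinality `n`, `k ≥ 3`, `n ≥ 2k+1`, and let
`𝓕` be an intersecting family of `k`-subsets of `Ω` whose members have no common element.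
Then `|𝓕| ≤ C(n-1,k-1) - C(n-k-1,k-1) + 1`, with equality iff either
(i) `𝓕 = {F} ∪ {G : |G| = k, x ∈ G, G ∩ F ≠ ∅}` for some `k`-subset `F` and `x ∉ F`, or
(ii) `k = 3` and `𝓕` is the set of all `3`-subsets meeting a fixed `3`-subset `F` in at
least `2` elements. -/
theorem hilton_milner {Ω : Type*} [Fintype Ω] [DecidableEq Ω] (n k : ℕ)
    (hn : Fintype.card Ω = n) (hk : 3 ≤ k) (hnk : 2 * k + 1 ≤ n)
    (𝓕 : Finset (Finset Ω))
    (hsize : ∀ A ∈ 𝓕, A.card = k)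
    (hint : ∀ A ∈ 𝓕, ∀ B ∈ 𝓕, (A ∩ B).Nonempty)
    (hnocommon : ¬ ∃ x : Ω, ∀ A ∈ 𝓕, x ∈ A) :
    𝓕.card ≤ (n - 1).choose (k - 1) - (n - k - 1).choose (k - 1) + 1 ∧
      (𝓕.card = (n - 1).choose (k - 1) - (n - k - 1).choose (k - 1) + 1 ↔
        ((∃ F : Finset Ω, F.card = k ∧ ∃ x ∉ F,
            𝓕 = insert F ((Finset.powersetCard k Finset.univ).filter
              (fun G => x ∈ G ∧ (G ∩ F).Nonempty))) ∨
         (k = 3 ∧ ∃ F : Finset Ω, F.card = 3 ∧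
            𝓕 = (Finset.powersetCard 3 Finset.univ).filter
              (fun G => 2 ≤ (G ∩ F).card)))) := by

  obtain ⟨r, rfl⟩ : ∃ r, k = r + 2 := ⟨k - 2, by omega⟩
  have hr : 1 ≤ r := by omega
  have hF : 𝓕 ⊆ Finset.powersetCard (r + 2) Finset.univ := by
    intro A hA
    exact Finset.mem_powersetCard.2 ⟨Finset.subset_univ _, hsize A hA⟩
  have hcr : Cross 𝓕 𝓕 := by
    intro A hA B hB
    obtain ⟨e, he⟩ := hint A hA B hB
    exact ⟨e, Finset.mem_inter.1 he⟩
  have hnt : ∀ x, ∃ S ∈ 𝓕, x ∉ S := by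
    intro x
    by_contra hc
    push Not at hc
    exact hnocommon ⟨x, hc⟩
  have e1 : r + 2 - 1 = r + 1 := by omega
  have e2 : n - (r + 2) - 1 = n - (r + 3) := by omega
  have hle : (n - (r + 3)).choose (r + 1) ≤ (n - 1).choose (r + 1) :=
    Nat.choose_le_choose _ (by omega)
  rw [e1, e2]
  have key : 𝓕.card + (n - (r + 3)).choose (r + 1) ≤ (n - 1).choose (r + 1) + 1 ∧
    ((n - 1).choose (r + 1) + 1 ≤ 𝓕.card + (n - (r + 3)).choose (r + 1) →
      (∃ z, ∃ G ∈ 𝓕, z ∉ G ∧ ∀ S ∈ 𝓕, S ≠ G → z ∈ S) ∨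
      (r = 1 ∧ ∃ T : Finset Ω, T.card = 3 ∧ ∀ S ∈ 𝓕, 2 ≤ (S ∩ T).card)) := by
    by_cases hc : ∀ x y, ∃ S ∈ 𝓕, x ∉ S ∧ y ∉ S
    · have := no_cover_gen hr (by omega) hF hcr hc
      rw [hn] at this
      exact ⟨this.le, fun h => by omega⟩
    · push Not at hc
      obtain ⟨x, y, hxy⟩ := hc
      have := two_cover hr (by rw [Finset.card_univ]; omega) hF hcr hnt (x := x) (y := y) (by
        intro S hS
        have := hxy S hS
        tauto)
      rwa [Finset.card_univ, hn] at this
  have cHM : ∀ (F : Finset Ω) (x : Ω), F.card = r + 2 → x ∉ F →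
      (insert F ((Finset.powersetCard (r + 2) Finset.univ).filter
        (fun G => x ∈ G ∧ (G ∩ F).Nonempty))).card + (n - (r + 3)).choose (r + 1)
        = (n - 1).choose (r + 1) + 1 := by
    intro F x h1 h2
    have := count_hm (r := r + 1) h1 h2
    rwa [hn, show n - 1 - (r + 1 + 1) = n - (r + 3) by omega] at this
  have cT : ∀ T : Finset Ω, r = 1 → T.card = 3 →
      ((Finset.powersetCard 3 Finset.univ).filter (fun G => 2 ≤ (G ∩ T).card)).card
        + (n - (r + 3)).choose (r + 1) = (n - 1).choose (r + 1) + 1 := by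
    rintro T rfl h1
    have := count_tri h1 (by omega)
    rwa [hn, show n - 1 - 3 = n - (1 + 3) by omega] at this
  refine ⟨by omega, ?_, ?_⟩
  · intro heq
    rcases key.2 (by omega) with ⟨z, G, hG, hzG, hz⟩ | ⟨hr1, T, hT, hST⟩
    · left
      refine ⟨G, hsize G hG, z, hzG, ?_⟩
      apply Finset.eq_of_subset_of_card_le
      · intro S hS
        by_cases hSG : S = G
        · exact hSG ▸ Finset.mem_insert_self _ _
        · exact Finset.mem_insert_of_mem (Finset.mem_filter.2 ⟨hF hS, hz S hS hSG, hint S hS G hG⟩)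
      · have := cHM G z (hsize G hG) hzG
        omega
    · right
      refine ⟨by omega, T, hT, ?_⟩
      apply Finset.eq_of_subset_of_card_le
      · intro S hS
        have h3 := hF hS
        rw [hr1] at h3
        exact Finset.mem_filter.2 ⟨h3, hST S hS⟩
      · have := cT T hr1 hT
        omega
  · rintro (⟨F, hFc, x, hx, h⟩ | ⟨hk3, T, hT, h⟩)
    · have := cHM F x hFc hx
      rw [← h] at this
      omega
    · have := cT T (by omega) hT
      rw [← h] at this
      omega
end
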